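/- arXiv:2009.05095 — 3 statements merged into one kernel-verified Lean document; each statement's English description precedes it below -/
import Mathlib

section
/- Let A be a traceless operator on the first k' sites with ‖A‖ = 1, let f : [−1,1] → {z ∈ ℂ : |z| ≤ 1} be a smooth function, and suppose H_N ≠ 0 for some sufficiently large N, so that τ_h = tr(H_N h)/d > 0 and τ_A = tr(H_N A)/d are N-independent constants for large N. If there exists a strictly increasing sequence (N_i) of positive integers such that √(N_i) · r_f(N_i) → 0 as i → ∞, then f'(0) = τ_A/τ_h. -/
open Matrix MeasureTheory Filter

/-- The space of operators on a chain of `N` qudits, each of local dimension `dloc`. -/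
abbrev Op (dloc N : ℕ) := Matrix (Fin N → Fin dloc) (Fin N → Fin dloc) ℂ

/-- Cyclic translation of qudit configurations: site `i` of the new configuration carries
the value of site `i - 1` of the old one. -/
def confShift (dloc N : ℕ) : Equiv.Perm (Fin N → Fin dloc) :=
  Equiv.arrowCongr (finRotate N) (Equiv.refl (Fin dloc))

/-- The translation operator `T` on a chain of `N` qudits, as a permutation matrix. -/
noncomputable def Tmat (dloc N : ℕ) : Op dloc N :=
  fun x y => if x = confShift dloc N y then 1 else 0

/-- Extension of an operator on the first `m` sites to the `N`-site chain, by tensoring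
with the identity on the remaining sites (the zero operator if `m > N`). -/
noncomputable def embed (dloc m N : ℕ) (a : Op dloc m) : Op dloc N :=
  if hm : m ≤ N then
    (fun x y => a (fun i => x (Fin.castLE hm i)) (fun i => y (Fin.castLE hm i)) *
      (if ∀ i : Fin N, m ≤ (i : ℕ) → x i = y i then 1 else 0))
  else 0

/-- The translation-invariant Hamiltonian `H_N = ∑_{l=0}^{N-1} T^l h T^{-l}` built from
a local term `h` on `k` sites. -/
noncomputable def Ham (dloc k N : ℕ) (h : Op dloc k) : Op dloc N :=
  ∑ l : Fin N, Tmat dloc N ^ (l : ℕ) * embed dloc k N h * (Tmat dloc N)ᴴ ^ (l : ℕ)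

/-- The operator norm (ℓ²→ℓ² norm) of a matrix. -/
noncomputable def opNorm {n : Type*} [Fintype n] [DecidableEq n] (A : Matrix n n ℂ) : ℝ :=
  ‖Matrix.toEuclideanCLM (𝕜 := ℂ) (n := n) A‖

/-- An orthonormal basis of simultaneous eigenvectors of the Hamiltonian `H` (with real
eigenvalues `E j`) and of the translation operator `T` (with eigenvalues `τ j`). -/
structure EigData (dloc N : ℕ) (H : Op dloc N) where
  v : (Fin N → Fin dloc) → ((Fin N → Fin dloc) → ℂ)
  E : (Fin N → Fin dloc) → ℝ
  τ : (Fin N → Fin dloc) → ℂ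
  orth : ∀ j j', star (v j) ⬝ᵥ v j' = if j = j' then 1 else 0
  eigH : ∀ j, H.mulVec (v j) = (E j : ℂ) • v j
  eigT : ∀ j, (Tmat dloc N).mulVec (v j) = τ j • v j

/-- The eigenstate expectation value `⟨j|B|j⟩`. -/
noncomputable def eev {dloc N : ℕ} {H : Op dloc N} (D : EigData dloc N H)
    (B : Op dloc N) (j : Fin N → Fin dloc) : ℂ :=
  star (D.v j) ⬝ᵥ B.mulVec (D.v j)

/-- `r_f(N) = ((1/d) ∑_j |⟨j|B|j⟩ - f(E_j/N)|²)^{1/2}`. -/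
noncomputable def rf {dloc N : ℕ} {H : Op dloc N} (D : EigData dloc N H)
    (B : Op dloc N) (f : ℝ → ℂ) : ℝ :=
  Real.sqrt ((1 / (dloc : ℝ) ^ N) * ∑ j, ‖eev D B j - f (D.E j / N)‖ ^ 2)

/-- A function `f : [-1,1] → {z : ℂ, |z| ≤ 1}` (encoded as a total function on `ℝ`)
is smooth with Taylor data `c0 = f(0)`, `c1 = f'(0)`, `c2 = f''(0)` and remainder
constant `M` if `|f(x) - c0 - c1 x - (c2/2) x²| ≤ M |x|³` on `[-1,1]`. -/
def SmoothFn (f : ℝ → ℂ) (c0 c1 c2 : ℂ) (M : ℝ) : Prop :=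
  0 ≤ M ∧ (∀ x ∈ Set.Icc (-1 : ℝ) 1, ‖f x‖ ≤ 1) ∧
    ∀ x ∈ Set.Icc (-1 : ℝ) 1, ‖f x - c0 - c1 * x - c2 / 2 * x ^ 2‖ ≤ M * |x| ^ 3

/-- The generalized Pauli string `X^{a_1}Z^{b_1} ⊗ ⋯ ⊗ X^{a_m}Z^{b_m}` on `m` qudits,
where `X|x⟩ = |x+1 mod dloc⟩` and `Z|x⟩ = ω^x |x⟩` with `ω = exp(2πi/dloc)`. -/
noncomputable def pauli (dloc m : ℕ) (a b : Fin m → Fin dloc) : Op dloc m :=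
  fun x y =>
    if ∀ i, (x i : ℕ) = ((y i : ℕ) + (a i : ℕ)) % dloc then
      ∏ i, Complex.exp (2 * Real.pi * Complex.I * (b i : ℕ) * (y i : ℕ) / dloc)
    else 0

/-- An operator on `k` sites is canonical if every generalized Pauli string with nonzero
coefficient in its expansion acts nontrivially on site 1. -/
def Canonical (dloc k : ℕ) (h : Op dloc k) : Prop :=
  ∀ a b : Fin k → Fin dloc,
    (∀ i : Fin k, (i : ℕ) = 0 → (a i : ℕ) = 0 ∧ (b i : ℕ) = 0) →
      Matrix.trace ((pauli dloc k a b)ᴴ * h) = 0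

/-- An operator on `k` sites is exactly `k`-local if some generalized Pauli string with
nonzero coefficient in its expansion acts nontrivially on site `k`. -/
def ExactlyLocal (dloc k : ℕ) (h : Op dloc k) : Prop :=
  ∃ a b : Fin k → Fin dloc, ∃ i : Fin k, (i : ℕ) = k - 1 ∧ ((a i : ℕ) ≠ 0 ∨ (b i : ℕ) ≠ 0) ∧
    Matrix.trace ((pauli dloc k a b)ᴴ * h) ≠ 0

/-- The submodule (over `ℝ`) of traceless operators on `k'` sites. -/
noncomputable def tracelessOps (dloc k' : ℕ) : Submodule ℝ (Op dloc k') :=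
  LinearMap.ker ((Matrix.traceLinearMap (Fin k' → Fin dloc) ℂ ℂ).restrictScalars ℝ)

/-- The translation average `𝔸 = (1/N) ∑_{l=0}^{N-1} T^l A T^{-l}` of an operator. -/
noncomputable def tavg (dloc N : ℕ) (A : Op dloc N) : Op dloc N :=
  ((N : ℂ))⁻¹ • ∑ l : Fin N, Tmat dloc N ^ (l : ℕ) * A * (Tmat dloc N)ᴴ ^ (l : ℕ)

namespace QuditChain

open scoped Kronecker Matrix.Norms.L2Operator

set_option linter.unusedSectionVars false

section Place

variable {ι κ κ' : Type*} [Fintype ι] [DecidableEq ι] [Fintype κ] [DecidableEq κ]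
  [Fintype κ'] [DecidableEq κ'] {q : ℕ}

/-- The sites outside the range of a placement `g`. -/
abbrev Off (g : κ ↪ ι) : Type _ := {i : ι // ∀ s, g s ≠ i}

/-- Configurations split into their restrictions along `g` and off the range of `g`. -/
noncomputable def siteSplit (q : ℕ) (g : κ ↪ ι) :
    (ι → Fin q) ≃ (κ → Fin q) × (Off g → Fin q) :=
  Equiv.ofBijective (fun x => (x ∘ g, fun i => x i)) <| by
    constructor
    · intro x y hxy
      simp only [Prod.mk.injEq] at hxy
      funext i
      by_cases hi : ∃ s, g s = i
      · obtain ⟨s, rfl⟩ := hi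
        exact congrFun hxy.1 s
      · push Not at hi
        exact congrFun hxy.2 ⟨i, hi⟩
    · rintro ⟨u, w⟩
      refine ⟨fun i => if hi : ∀ s, g s ≠ i then w ⟨i, hi⟩ else
        u (Classical.choose (not_forall_not.mp hi)), ?_⟩
      ext s
      · have hs : ¬ ∀ s', g s' ≠ g s := fun hs => hs s rfl
        have := Classical.choose_spec (not_forall_not.mp hs)
        simp only [Function.comp_apply, dif_neg hs]
        rw [g.injective this]
      · simp [s.2]

lemma siteSplit_apply (g : κ ↪ ι) (x : ι → Fin q) :
    siteSplit q g x = (x ∘ g, fun i : Off g => x i) := rfl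

/-- The operator `a`, defined on sites `κ`, acting on the sites `g κ` of a system with sites `ι`,
as a homomorphism of star algebras. -/
noncomputable def place (g : κ ↪ ι) : Matrix (κ → Fin q) (κ → Fin q) ℂ →⋆ₐ[ℂ]
    Matrix (ι → Fin q) (ι → Fin q) ℂ where
  toFun a := (a ⊗ₖ (1 : Matrix (Off g → Fin q) (Off g → Fin q) ℂ)).submatrix
    (siteSplit q g) (siteSplit q g)
  map_one' := by simp
  map_mul' a b := by
    rw [Matrix.submatrix_mul_equiv, ← Matrix.mul_kronecker_mul, one_mul]
  map_zero' := by simp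
  map_add' a b := by
    rw [Matrix.add_kronecker]; rfl
  commutes' c := by
    rw [Algebra.algebraMap_eq_smul_one, Algebra.algebraMap_eq_smul_one, Matrix.smul_kronecker,
      Matrix.one_kronecker_one, Matrix.submatrix_smul]
    simp
  map_star' a := by
    simp only [Matrix.star_eq_conjTranspose, Matrix.conjTranspose_submatrix,
      Matrix.conjTranspose_kronecker, Matrix.conjTranspose_one]

lemma place_eq_submatrix (g : κ ↪ ι) (a : Matrix (κ → Fin q) (κ → Fin q) ℂ) :
    place g a = (a ⊗ₖ (1 : Matrix (Off g → Fin q) (Off g → Fin q) ℂ)).submatrix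
      (siteSplit q g) (siteSplit q g) := rfl

lemma place_apply (g : κ ↪ ι) (a : Matrix (κ → Fin q) (κ → Fin q) ℂ) (x y : ι → Fin q) :
    place g a x y = a (x ∘ g) (y ∘ g) * if ∀ i, (∀ s, g s ≠ i) → x i = y i then 1 else 0 := by
  rw [place_eq_submatrix, Matrix.submatrix_apply, Matrix.kroneckerMap_apply, Matrix.one_apply]
  congr 1
  simp [siteSplit_apply, funext_iff]

lemma norm_place_le (g : κ ↪ ι) (a : Matrix (κ → Fin q) (κ → Fin q) ℂ) : ‖place g a‖ ≤ ‖a‖ :=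
  NonUnitalStarAlgHom.norm_apply_le (place g) a

lemma place_trans {μ : Type*} [Fintype μ] [DecidableEq μ] (g : κ ↪ ι) (φ : ι ↪ μ)
    (a : Matrix (κ → Fin q) (κ → Fin q) ℂ) : place (g.trans φ) a = place φ (place g a) := by
  ext x y
  simp only [place_apply, mul_assoc]
  congr 1
  rw [ite_zero_mul_ite_zero, mul_one]
  congr 1
  simp only [Function.Embedding.trans_apply, ne_eq, Function.comp_apply, eq_iff_iff]
  constructor
  · exact fun H => ⟨fun i hi => H _ fun s hs => hi s (φ.injective hs),
      fun i hi => H i fun s => hi _⟩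
  · rintro ⟨H1, H2⟩ i hi
    by_cases hφ : ∃ j, φ j = i
    · obtain ⟨j, rfl⟩ := hφ
      exact H1 j fun s hs => hi s (by rw [hs])
    · exact H2 i (not_exists.mp hφ)

lemma trace_submatrix_equiv {m n : Type*} [Fintype m] [Fintype n] (e : m ≃ n)
    (B : Matrix n n ℂ) : (B.submatrix e e).trace = B.trace := by
  simpa [Matrix.trace] using e.sum_comp (fun i => B i i)

lemma trace_place (g : κ ↪ ι) (a : Matrix (κ → Fin q) (κ → Fin q) ℂ) :
    (place g a).trace * (q : ℂ) ^ Fintype.card κ = a.trace * (q : ℂ) ^ Fintype.card ι := by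
  have hcard := Fintype.card_congr (siteSplit q g)
  simp only [Fintype.card_prod, Fintype.card_fun, Fintype.card_fin] at hcard
  rw [place_eq_submatrix, trace_submatrix_equiv, Matrix.trace_kronecker, Matrix.trace_one,
    ← Nat.cast_pow _ (Fintype.card ι), hcard]
  simp only [Fintype.card_fun, Fintype.card_fin]
  push_cast
  ring

/-- The operator `X` acts as the identity on the sites in the range of `g`. -/
def ActsTrivially (g : κ ↪ ι) (X : Matrix (ι → Fin q) (ι → Fin q) ℂ) : Prop :=
  ∃ Y : Matrix (Off g → Fin q) (Off g → Fin q) ℂ,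
    X = ((1 : Matrix (κ → Fin q) (κ → Fin q) ℂ) ⊗ₖ Y).submatrix (siteSplit q g) (siteSplit q g)

lemma ActsTrivially.mul {g : κ ↪ ι} {X X' : Matrix (ι → Fin q) (ι → Fin q) ℂ}
    (hX : ActsTrivially g X) (hX' : ActsTrivially g X') : ActsTrivially g (X * X') := by
  obtain ⟨Y, rfl⟩ := hX
  obtain ⟨Y', rfl⟩ := hX'
  exact ⟨Y * Y', by rw [Matrix.submatrix_mul_equiv, ← Matrix.mul_kronecker_mul, one_mul]⟩

lemma trace_place_mul_eq_zero {g : κ ↪ ι} {X : Matrix (ι → Fin q) (ι → Fin q) ℂ}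
    (hX : ActsTrivially g X) {a : Matrix (κ → Fin q) (κ → Fin q) ℂ} (ha : a.trace = 0) :
    (place g a * X).trace = 0 := by
  obtain ⟨Y, rfl⟩ := hX
  rw [place_eq_submatrix, Matrix.submatrix_mul_equiv, ← Matrix.mul_kronecker_mul,
    trace_submatrix_equiv, Matrix.trace_kronecker, mul_one, ha, zero_mul]

lemma actsTrivially_place {g : κ ↪ ι} {g' : κ' ↪ ι} (hg : ∀ s s', g s ≠ g' s')
    (a : Matrix (κ' → Fin q) (κ' → Fin q) ℂ) : ActsTrivially g (place g' a) := by
  let g'' : κ' ↪ Off g := ⟨fun s' => ⟨g' s', fun s => hg s s'⟩, fun s t hst => by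
    simpa using hst⟩
  refine ⟨place g'' a, ?_⟩
  ext x y
  rw [Matrix.submatrix_apply, Matrix.kroneckerMap_apply, place_apply, place_apply, Matrix.one_apply,
    mul_left_comm, ite_zero_mul_ite_zero, mul_one]
  congr 2
  simp only [siteSplit_apply, funext_iff, Function.comp_apply, eq_iff_iff,
    Subtype.forall, ne_eq]
  constructor
  · exact fun H => ⟨fun s => H _ fun s' hs => hg s s' hs.symm,
      fun i hi hi' => H i fun s' hs => hi' s' (Subtype.ext hs)⟩
  · rintro ⟨H1, H2⟩ i hi
    by_cases hi' : ∃ s, g s = i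
    · obtain ⟨s, rfl⟩ := hi'
      exact H1 s
    · exact H2 i (not_exists.mp hi') fun s' hs => hi s' (congrArg Subtype.val hs)

end Place

section Chain

variable {q m N : ℕ}

/-- The placement of `m` consecutive sites on the cyclic chain of `N` sites, starting at `s`. -/
def segment (hmN : m ≤ N) (s : ℕ) : Fin m ↪ Fin N where
  toFun i := ⟨(i + s) % N, Nat.mod_lt _ (i.pos.trans_le hmN)⟩
  inj' i j hij := by
    have h1 : (i + s) ≡ (j + s) [MOD N] := congrArg Fin.val hij
    have h2 := Nat.ModEq.add_right_cancel' s h1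
    exact Fin.ext (h2.eq_of_lt_of_lt (i.2.trans_le hmN) (j.2.trans_le hmN))

@[simp]
lemma segment_val (hmN : m ≤ N) (s : ℕ) (i : Fin m) : (segment hmN s i : ℕ) = (i + s) % N := rfl

lemma segment_congr (hmN : m ≤ N) {s t : ℕ} (hst : s ≡ t [MOD N]) :
    segment hmN s = segment hmN t := by
  ext i
  exact Nat.ModEq.add_left (i : ℕ) hst

lemma segment_trans {W : ℕ} (hmW : m ≤ W) (hWN : W ≤ N) {s : ℕ} (hs : m + s ≤ W) (t : ℕ) :
    (segment hmW s).trans (segment hWN t) = segment (hmW.trans hWN) (s + t) := by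
  ext i
  have hi : (i + s) % W = i + s := Nat.mod_eq_of_lt (by omega)
  simp [hi, add_assoc]

lemma segment_trans_finRotate (hmN : m ≤ N) (s : ℕ) :
    (segment hmN s).trans (finRotate N).toEmbedding = segment hmN (s + 1) := by
  ext i
  obtain _ | N := N
  · exact absurd (i.pos.trans_le hmN) (lt_irrefl _)
  · simp [Fin.val_add, add_assoc]

lemma segment_start_injective (hmN : m ≤ N) (i : Fin m) :
    Function.Injective fun s : Fin N => segment hmN s i := by
  intro s t hst
  have h1 : (i + s : ℕ) ≡ (i + t) [MOD N] := congrArg Fin.val hst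
  exact Fin.ext ((Nat.ModEq.add_left_cancel' (i : ℕ) h1).eq_of_lt_of_lt s.2 t.2)

lemma embed_eq_place (hmN : m ≤ N) (a : Op q m) : embed q m N a = place (segment hmN 0) a := by
  ext x y
  have hembed : embed q m N a x y = a (fun i => x (Fin.castLE hmN i))
      (fun i => y (Fin.castLE hmN i)) *
      (if ∀ i : Fin N, m ≤ (i : ℕ) → x i = y i then 1 else 0) := by
    have hE : embed q m N a = _ := dif_pos hmN
    rw [hE]
  rw [hembed, place_apply]
  have hseg : ∀ i : Fin m, segment hmN 0 i = Fin.castLE hmN i := fun i =>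
    Fin.ext (by simpa using Nat.mod_eq_of_lt (i.2.trans_le hmN))
  have hoff : ∀ i : Fin N, (∀ s, segment hmN 0 s ≠ i) ↔ m ≤ (i : ℕ) := by
    intro i
    simp only [hseg]
    constructor
    · intro hi
      by_contra! hlt
      exact hi ⟨i, hlt⟩ rfl
    · rintro hi s rfl
      exact absurd s.2 (not_lt.mpr hi)
  simp only [hoff]
  congr 2 <;> (funext i; simp [hseg])

lemma confShift_symm_apply (x : Fin N → Fin q) (i : Fin N) :
    (confShift q N).symm x i = x (finRotate N i) := rfl

lemma Tmat_conj (B : Op q N) : Tmat q N * B * (Tmat q N)ᴴ =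
    B.submatrix (confShift q N).symm (confShift q N).symm := by
  ext x y
  simp [Matrix.mul_apply, Tmat, ← Equiv.symm_apply_eq (confShift q N), apply_ite]

lemma Tmat_mul_conjTranspose : Tmat q N * (Tmat q N)ᴴ = 1 := by
  simpa using Tmat_conj (1 : Op q N)

lemma Tmat_conj_place (g : Fin m ↪ Fin N) (a : Op q m) :
    Tmat q N * place g a * (Tmat q N)ᴴ = place (g.trans (finRotate N).toEmbedding) a := by
  rw [Tmat_conj]
  ext x y
  rw [Matrix.submatrix_apply, place_apply, place_apply]
  congr 2
  refine propext ⟨fun H i hi => ?_, fun H i hi => ?_⟩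
  · simpa only [confShift_symm_apply, Equiv.apply_symm_apply] using
      H ((finRotate N).symm i) fun s hs => hi s <|
      (Equiv.eq_symm_apply _).mp hs
  · simpa only [confShift_symm_apply] using H (finRotate N i) fun s hs => hi s (by simpa using hs)

lemma Tmat_pow_conj_embed (hmN : m ≤ N) (a : Op q m) (l : ℕ) :
    Tmat q N ^ l * embed q m N a * (Tmat q N)ᴴ ^ l = place (segment hmN l) a := by
  induction l with
  | zero => simp [embed_eq_place hmN]
  | succ l ih =>
    rw [← segment_trans_finRotate, ← Tmat_conj_place, ← ih, pow_succ', pow_succ]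
    simp only [mul_assoc]

lemma Ham_eq_sum_place (hmN : m ≤ N) (h : Op q m) :
    Ham q m N h = ∑ l : Fin N, place (segment hmN l) h :=
  Finset.sum_congr rfl fun _ _ => Tmat_pow_conj_embed hmN h _

lemma trace_place_eq_zero (g : Fin m ↪ Fin N) {a : Op q m} (ha : a.trace = 0) :
    (place g a).trace = 0 := by
  have hX : ActsTrivially g (1 : Op q N) := ⟨1, by simp⟩
  simpa using trace_place_mul_eq_zero hX ha

/-- The normalized trace of the Hamiltonian against a local operator does not depend on the
length of the chain once the chain is long enough. -/
lemma trace_Ham_mul_embed {k k' : ℕ} (hq : q ≠ 0) (h : Op q k) (htr : h.trace = 0)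
    (A : Op q k') :
    ∃ t : ℂ, ∀ N, 2 * k + k' ≤ N → (Ham q k N h * embed q k' N A).trace = t * (q : ℂ) ^ N := by
  have hk : k ≤ 2 * k + k' := by omega
  have hk' : k' ≤ 2 * k + k' := by omega
  have hq' : (q : ℂ) ≠ 0 := Nat.cast_ne_zero.mpr hq
  refine ⟨(∑ s : Fin (k + k'), (place (segment hk s) h * place (segment hk' k) A).trace) /
    (q : ℂ) ^ (2 * k + k'), fun N hN => ?_⟩
  have hkN := hk.trans hN
  have hk'N := hk'.trans hN
  have hwin : k + k' ≤ N := by omega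
  rw [Ham_eq_sum_place hkN, embed_eq_place hk'N, Finset.sum_mul, Matrix.trace_sum,
    div_mul_eq_mul_div,
    eq_div_iff (pow_ne_zero _ hq'), Finset.sum_mul, Finset.sum_mul]
  symm
  refine Fintype.sum_of_injective (segment hwin (N - k)) (segment hwin (N - k)).injective _ _ ?_ ?_
  · intro l hl
    have hl' : k' ≤ l ∧ l + k < N := by
      by_contra hcon
      apply hl
      by_cases hlk : (l : ℕ) < k'
      · refine ⟨⟨l + k, by omega⟩, Fin.ext ?_⟩
        have : (l : ℕ) + k + (N - k) = l + N := by omega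
        simp [this, Nat.mod_eq_of_lt l.2]
      · refine ⟨⟨l - (N - k), by omega⟩, Fin.ext ?_⟩
        have : (l : ℕ) - (N - k) + (N - k) = l := by omega
        simp [this, Nat.mod_eq_of_lt l.2]
    rw [trace_place_mul_eq_zero (actsTrivially_place (fun s s' hs => ?_) A) htr, zero_mul]
    have h1 := congrArg Fin.val hs
    rw [segment_val, segment_val, Nat.mod_eq_of_lt (by omega), Nat.mod_eq_of_lt (by omega)] at h1
    omega
  · intro s
    have h1 : segment hkN (segment hwin (N - k) s : ℕ) =
        (segment hk s).trans (segment hN (N - k)) := by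
      rw [segment_trans hk hN (by omega)]
      exact segment_congr _ (Nat.mod_modEq _ _)
    have h2 : segment hk'N 0 = (segment hk' k).trans (segment hN (N - k)) := by
      rw [segment_trans hk' hN (by omega)]
      refine segment_congr _ ?_
      rw [show k + (N - k) = N by omega]
      exact (Nat.modEq_zero_iff_dvd.mpr dvd_rfl).symm
    rw [h1, h2, place_trans, place_trans, ← map_mul]
    simpa only [Fintype.card_fin] using (trace_place (segment hN (N - k)) _).symm

end Chain

section FourthMoment

lemma norm_star_dotProduct_mulVec_le {n : Type*} [Fintype n] [DecidableEq n] (X : Matrix n n ℂ)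
    {v : n → ℂ} (hv : star v ⬝ᵥ v = 1) : ‖star v ⬝ᵥ X *ᵥ v‖ ≤ ‖X‖ := by
  set w : EuclideanSpace ℂ n := WithLp.toLp 2 v with hw
  have hinner : ∀ u : n → ℂ, inner ℂ w (WithLp.toLp 2 u) = star v ⬝ᵥ u := fun u => by
    rw [hw, EuclideanSpace.inner_toLp_toLp, dotProduct_comm]
  have hw1 : ‖w‖ = 1 := by
    have h1 : inner ℂ w w = (1 : ℂ) := by rw [← hv]; exact hinner v
    rw [norm_eq_sqrt_re_inner (𝕜 := ℂ), h1]
    simp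
  rw [← hinner]
  calc ‖inner ℂ w (WithLp.toLp 2 (X *ᵥ v))‖ ≤ ‖w‖ * ‖WithLp.toLp 2 (X *ᵥ v)‖ :=
        norm_inner_le_norm _ _
    _ ≤ ‖w‖ * (‖X‖ * ‖w‖) := by gcongr; exact Matrix.l2_opNorm_mulVec X w
    _ = ‖X‖ := by rw [hw1]; ring

lemma norm_trace_le {n : Type*} [Fintype n] [DecidableEq n] (X : Matrix n n ℂ) :
    ‖X.trace‖ ≤ Fintype.card n * ‖X‖ := by
  have hdiag : ∀ i, ‖X i i‖ ≤ ‖X‖ := fun i => by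
    have hi : star (Pi.single i 1 : n → ℂ) ⬝ᵥ Pi.single i 1 = 1 := by simp
    simpa [← Pi.single_star] using norm_star_dotProduct_mulVec_le X hi
  calc ‖X.trace‖ ≤ ∑ i, ‖X i i‖ := norm_sum_le _ _
    _ ≤ ∑ _i : n, ‖X‖ := Finset.sum_le_sum fun i _ => hdiag i
    _ = _ := by simp

/-- If every vertex of a graph has at most `C` neighbours, the number of
quadruples of vertices without an isolated member is quadratic in the number of vertices. -/
lemma sum_quadruple_le {ι : Type*} [Fintype ι] {R : ι → ι → Prop} [DecidableRel R]
    (hR : ∀ a b, R a b → R b a) {C : ℝ} (hC : ∀ a, ∑ b, (if R a b then (1 : ℝ) else 0) ≤ C)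
    (F : ι → ι → ι → ι → ℝ) (hF1 : ∀ a b c e, F a b c e ≤ 1)
    (hF0 : ∀ a b c e, ¬ ((R a b ∨ R a c ∨ R a e) ∧ (R b a ∨ R b c ∨ R b e) ∧
      (R c a ∨ R c b ∨ R c e) ∧ (R e a ∨ R e b ∨ R e c)) → F a b c e = 0) :
    ∑ a, ∑ b, ∑ c, ∑ e, F a b c e ≤ 7 * C ^ 2 * (Fintype.card ι : ℝ) ^ 2 := by
  set r : ι → ι → ℝ := fun a b => if R a b then 1 else 0 with hr
  have hr0 : ∀ a b, 0 ≤ r a b := fun a b => by simp only [hr]; split_ifs <;> norm_num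
  have hr1 : ∀ a b, r a b ≤ 1 := fun a b => by simp only [hr]; split_ifs <;> norm_num
  have hrsymm : ∀ a b, r a b = r b a := fun a b => by
    simp only [hr, show R a b ↔ R b a from ⟨hR a b, hR b a⟩]
  have hrow : ∀ a, ∑ b, r a b ≤ C := hC
  have hcol : ∀ a, ∑ b, r b a ≤ C := fun a => by simpa only [hrsymm _ a] using hC a
  have hF : ∀ a b c e, F a b c e ≤ r a b * r c e + r a c * r b e + r a e * r b c +
      r a b * (r a c * r a e) + r b a * (r b c * r b e) + r c a * (r c b * r c e) +
      r e a * (r e b * r e c) := by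
    intro a b c e
    have hn : ∀ a b, R a b → r a b = 1 := fun a b hab => by simp [hr, hab]
    have hpos : 0 ≤ r a b * r c e ∧ 0 ≤ r a c * r b e ∧ 0 ≤ r a e * r b c ∧
        0 ≤ r a b * (r a c * r a e) ∧ 0 ≤ r b a * (r b c * r b e) ∧
        0 ≤ r c a * (r c b * r c e) ∧ 0 ≤ r e a * (r e b * r e c) := by
      refine ⟨?_, ?_, ?_, ?_, ?_, ?_, ?_⟩ <;> simp only [mul_nonneg, hr0]
    obtain ⟨h1, h2, h3, h4, h5, h6, h7⟩ := hpos
    by_cases hiso : (R a b ∨ R a c ∨ R a e) ∧ (R b a ∨ R b c ∨ R b e) ∧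
      (R c a ∨ R c b ∨ R c e) ∧ (R e a ∨ R e b ∨ R e c)
    · have hpattern : (R a b ∧ R c e) ∨ (R a c ∧ R b e) ∨ (R a e ∧ R b c) ∨
          (R a b ∧ R a c ∧ R a e) ∨ (R b a ∧ R b c ∧ R b e) ∨ (R c a ∧ R c b ∧ R c e) ∨
          (R e a ∧ R e b ∧ R e c) := by
        grind
      have hF1' := hF1 a b c e
      rcases hpattern with ⟨p, p'⟩ | ⟨p, p'⟩ | ⟨p, p'⟩ | ⟨p, p', p''⟩ | ⟨p, p', p''⟩ |
        ⟨p, p', p''⟩ | ⟨p, p', p''⟩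
      · have : r a b * r c e = 1 := by rw [hn _ _ p, hn _ _ p', mul_one]
        linarith
      · have : r a c * r b e = 1 := by rw [hn _ _ p, hn _ _ p', mul_one]
        linarith
      · have : r a e * r b c = 1 := by rw [hn _ _ p, hn _ _ p', mul_one]
        linarith
      · have : r a b * (r a c * r a e) = 1 := by rw [hn _ _ p, hn _ _ p', hn _ _ p'']; norm_num
        linarith
      · have : r b a * (r b c * r b e) = 1 := by rw [hn _ _ p, hn _ _ p', hn _ _ p'']; norm_num
        linarith
      · have : r c a * (r c b * r c e) = 1 := by rw [hn _ _ p, hn _ _ p', hn _ _ p'']; norm_num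
        linarith
      · have : r e a * (r e b * r e c) = 1 := by rw [hn _ _ p, hn _ _ p', hn _ _ p'']; norm_num
        linarith
    · rw [hF0 a b c e hiso]
      linarith
  obtain hι | ⟨⟨i₀⟩⟩ := isEmpty_or_nonempty ι
  · simp
  have hC0 : 0 ≤ C := (Finset.sum_nonneg fun b _ => hr0 i₀ b).trans (hrow i₀)
  have hpair : ∀ a b, ∑ c, ∑ e, (r a c * r b e + r a e * r b c) ≤ 2 * C ^ 2 := by
    intro a b
    have h1 : ∑ c, ∑ e, (r a c * r b e + r a e * r b c) = 2 * ((∑ c, r a c) * ∑ e, r b e) := by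
      simp only [Finset.sum_add_distrib]
      rw [Finset.sum_comm (f := fun c e => r a e * r b c), Finset.sum_mul_sum]
      ring
    have h2 := mul_le_mul (hrow a) (hrow b) (Finset.sum_nonneg fun c _ => hr0 b c) hC0
    rw [h1]
    linarith
  have hfst : ∑ a, ∑ b, ∑ c, ∑ e, r a b * r c e ≤ C ^ 2 * (Fintype.card ι : ℝ) ^ 2 := by
    have htot : ∑ a, ∑ b, r a b ≤ C * Fintype.card ι :=
      (Finset.sum_le_sum fun a _ => hrow a).trans_eq (by simp [mul_comm])
    have h1 : ∑ a, ∑ b, ∑ c, ∑ e, r a b * r c e = (∑ a, ∑ b, r a b) * ∑ c, ∑ e, r c e := by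
      simp only [← Finset.mul_sum, ← Finset.sum_mul]
    have h2 := mul_le_mul htot htot (Finset.sum_nonneg fun c _ => Finset.sum_nonneg fun e _ =>
      hr0 c e) (by positivity)
    rw [h1]
    linarith
  have hstar : ∀ a b, ∑ c, ∑ e, (r a b * (r a c * r a e) + r b a * (r b c * r b e)) ≤
      r a b * (2 * C ^ 2) := by
    intro a b
    have h1 : ∑ c, ∑ e, (r a b * (r a c * r a e) + r b a * (r b c * r b e)) =
        r a b * ((∑ c, r a c) * (∑ e, r a e) + (∑ c, r b c) * ∑ e, r b e) := by
      rw [hrsymm b a]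
      simp only [Finset.sum_add_distrib, ← Finset.mul_sum, ← Finset.sum_mul]
      ring
    have h2 := mul_le_mul (hrow a) (hrow a) (Finset.sum_nonneg fun c _ => hr0 a c) hC0
    have h3 := mul_le_mul (hrow b) (hrow b) (Finset.sum_nonneg fun c _ => hr0 b c) hC0
    rw [h1]
    exact mul_le_mul_of_nonneg_left (by linarith) (hr0 a b)
  have hcentre : ∀ a b, ∑ c, ∑ e, (r c a * (r c b * r c e) + r e a * (r e b * r e c)) ≤
      2 * C ^ 2 := by
    intro a b
    have h1 : ∑ c, ∑ e, (r c a * (r c b * r c e) + r e a * (r e b * r e c)) =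
        2 * ∑ c, r c a * (r c b * ∑ e, r c e) := by
      simp only [Finset.sum_add_distrib]
      rw [Finset.sum_comm (f := fun c e => r e a * (r e b * r e c))]
      simp only [← Finset.mul_sum]
      ring
    have h2 : ∑ c, r c a * (r c b * ∑ e, r c e) ≤ ∑ c, r c a * C := by
      refine Finset.sum_le_sum fun c _ => mul_le_mul_of_nonneg_left ?_ (hr0 c a)
      calc r c b * ∑ e, r c e ≤ 1 * C :=
            mul_le_mul (hr1 c b) (hrow c) (Finset.sum_nonneg fun e _ => hr0 c e) zero_le_one
        _ = C := one_mul C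
    have h3 := mul_le_mul_of_nonneg_right (hcol a) hC0
    rw [← Finset.sum_mul] at h2
    rw [h1]
    linarith
  calc ∑ a, ∑ b, ∑ c, ∑ e, F a b c e
      ≤ ∑ a, ∑ b, ∑ c, ∑ e, (r a b * r c e + (r a c * r b e + r a e * r b c) +
          (r a b * (r a c * r a e) + r b a * (r b c * r b e)) +
          (r c a * (r c b * r c e) + r e a * (r e b * r e c))) := by
        gcongr with a _ b _ c _ e _
        linarith [hF a b c e]
    _ = ∑ a, ∑ b, ∑ c, ∑ e, r a b * r c e +
        ∑ a, ∑ b, (∑ c, ∑ e, (r a c * r b e + r a e * r b c) +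
          ∑ c, ∑ e, (r a b * (r a c * r a e) + r b a * (r b c * r b e)) +
          ∑ c, ∑ e, (r c a * (r c b * r c e) + r e a * (r e b * r e c))) := by
        simp only [Finset.sum_add_distrib]
        ring
    _ ≤ C ^ 2 * (Fintype.card ι : ℝ) ^ 2 +
        ∑ a : ι, ∑ b : ι, (2 * C ^ 2 + r a b * (2 * C ^ 2) + 2 * C ^ 2) := by
        gcongr with a _ b _
        exacts [hpair a b, hstar a b, hcentre a b]
    _ ≤ C ^ 2 * (Fintype.card ι : ℝ) ^ 2 +
        ∑ a : ι, ∑ b : ι, (2 * C ^ 2 + 1 * (2 * C ^ 2) + 2 * C ^ 2) := by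
        gcongr with a _ b _
        exact hr1 a b
    _ = 7 * C ^ 2 * (Fintype.card ι : ℝ) ^ 2 := by
        simp only [Finset.sum_const, Finset.card_univ, nsmul_eq_mul]
        ring

variable {q k N : ℕ}

/-- The translates of a `k`-site block starting at `a` and at `b` share a site. -/
def Overlap (hkN : k ≤ N) (a b : Fin N) : Prop :=
  ∃ s s', segment hkN a s = segment hkN b s'

instance (hkN : k ≤ N) : DecidableRel (Overlap hkN) := fun _ _ =>
  inferInstanceAs (Decidable (∃ _ _, _ = _))

lemma Overlap.symm {hkN : k ≤ N} {a b : Fin N} : Overlap hkN a b → Overlap hkN b a :=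
  fun ⟨s, s', hs⟩ => ⟨s', s, hs.symm⟩

lemma sum_overlap_le (hkN : k ≤ N) (a : Fin N) :
    ∑ b, (if Overlap hkN a b then (1 : ℝ) else 0) ≤ (k : ℝ) ^ 2 := by
  rw [Finset.sum_boole]
  have hcard : Fintype.card {b // Overlap hkN a b} ≤ Fintype.card (Fin k × Fin k) := by
    choose s s' hs using fun b : {b // Overlap hkN a b} => b.2
    refine Fintype.card_le_of_injective (fun b => (s b, s' b)) fun b b' hb => ?_
    simp only [Prod.mk.injEq] at hb
    refine Subtype.ext (segment_start_injective hkN (s' b) ?_)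
    have h1 := hs b'
    rw [← hb.1, ← hb.2, hs b] at h1
    exact h1
  rw [Fintype.card_subtype] at hcard
  simp only [Fintype.card_prod, Fintype.card_fin] at hcard
  rw [sq]
  exact_mod_cast hcard

lemma norm_trace_Ham_pow_four_le (hkN : k ≤ N) {h : Op q k} (htr : h.trace = 0) (hnorm : ‖h‖ ≤ 1) :
    ‖(Ham q k N h * (Ham q k N h * (Ham q k N h * Ham q k N h))).trace‖ ≤
      7 * ((k : ℝ) ^ 2) ^ 2 * (N : ℝ) ^ 2 * (q : ℝ) ^ N := by
  obtain rfl | hq := Nat.eq_zero_or_pos q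
  · obtain rfl | hN := Nat.eq_zero_or_pos N
    · simp [Ham]
    · have : Nonempty (Fin N) := ⟨⟨0, hN⟩⟩
      simp [Matrix.trace, hN.ne']
  have hqN : (0 : ℝ) < (q : ℝ) ^ N := by positivity
  set t : Fin N → Op q N := fun l => place (segment hkN l) h with ht
  have ht1 : ∀ l, ‖t l‖ ≤ 1 := fun l => (norm_place_le _ _).trans hnorm
  have hexp : (Ham q k N h * (Ham q k N h * (Ham q k N h * Ham q k N h))).trace =
      ∑ a, ∑ b, ∑ c, ∑ e, (t a * (t b * (t c * t e))).trace := by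
    rw [Ham_eq_sum_place hkN]
    simp only [Finset.sum_mul]
    simp only [Finset.mul_sum, Matrix.trace_sum, ht]
  have hvanish : ∀ a b c e, ¬ Overlap hkN a b → ¬ Overlap hkN a c → ¬ Overlap hkN a e →
      (t a * (t b * (t c * t e))).trace = 0 := by
    intro a b c e hab hac hae
    have hne : ∀ {b}, ¬ Overlap hkN a b → ActsTrivially (segment hkN a) (t b) := fun hb =>
      actsTrivially_place (fun s s' hs => hb ⟨s, s', hs⟩) h
    exact trace_place_mul_eq_zero ((hne hab).mul ((hne hac).mul (hne hae))) htr
  have hcyc : ∀ a b c e, (t a * (t b * (t c * t e))).trace = (t b * (t c * (t e * t a))).trace :=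
    fun a b c e => by rw [Matrix.trace_mul_comm]; simp only [mul_assoc]
  have hle : ∀ a b c e, ‖(t a * (t b * (t c * t e))).trace‖ ≤ (q : ℝ) ^ N := by
    intro a b c e
    refine (norm_trace_le _).trans ?_
    have h1 : ‖t a * (t b * (t c * t e))‖ ≤ 1 := by
      have := norm_mul_le_of_le (ht1 a) (norm_mul_le_of_le (ht1 b)
        (norm_mul_le_of_le (ht1 c) (ht1 e)))
      simpa using this
    simpa using mul_le_mul_of_nonneg_left h1 hqN.le
  have hsum := sum_quadruple_le (fun _ _ => Overlap.symm) (sum_overlap_le hkN)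
    (fun a b c e => ‖(t a * (t b * (t c * t e))).trace‖ / (q : ℝ) ^ N)
    (fun a b c e => (div_le_one hqN).mpr (hle a b c e)) ?_
  · rw [hexp, ← div_le_iff₀ hqN]
    refine le_trans ?_ (hsum.trans_eq (by simp))
    simp only [← Finset.sum_div]
    gcongr
    exact (norm_sum_le _ _).trans <| Finset.sum_le_sum fun a _ => (norm_sum_le _ _).trans <|
      Finset.sum_le_sum fun b _ => (norm_sum_le _ _).trans <|
      Finset.sum_le_sum fun c _ => norm_sum_le _ _
  · intro a b c e hR
    have hz : (t a * (t b * (t c * t e))).trace = 0 := by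
      by_cases ha : Overlap hkN a b ∨ Overlap hkN a c ∨ Overlap hkN a e
      · by_cases hb : Overlap hkN b a ∨ Overlap hkN b c ∨ Overlap hkN b e
        · by_cases hc : Overlap hkN c a ∨ Overlap hkN c b ∨ Overlap hkN c e
          · have he : ¬ (Overlap hkN e a ∨ Overlap hkN e b ∨ Overlap hkN e c) :=
              fun he => hR ⟨ha, hb, hc, he⟩
            push Not at he
            rw [hcyc, hcyc, hcyc]
            exact hvanish _ _ _ _ he.1 he.2.1 he.2.2
          · push Not at hc
            rw [hcyc, hcyc]
            exact hvanish _ _ _ _ hc.2.2 hc.1 hc.2.1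
        · push Not at hb
          rw [hcyc]
          exact hvanish _ _ _ _ hb.2.1 hb.2.2 hb.1
      · push Not at ha
        exact hvanish _ _ _ _ ha.1 ha.2.1 ha.2.2
    simp [hz]

end FourthMoment

section Eigenbasis

variable {q N : ℕ} {H : Op q N} (D : EigData q N H)

lemma sum_eev (B : Op q N) : ∑ j, eev D B j = B.trace := by
  set U : Op q N := Matrix.of fun x j => D.v j x with hU
  have hentry : ∀ X : Op q N, ∀ j j', (Uᴴ * X * U) j j' = star (D.v j) ⬝ᵥ X *ᵥ D.v j' := by
    intro X j j'
    rw [Matrix.mul_assoc]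
    rfl
  have hUU : Uᴴ * U = 1 := by
    ext j j'
    simpa [Matrix.one_apply, D.orth] using hentry 1 j j'
  have hUU' : U * Uᴴ = 1 := mul_eq_one_comm.mp hUU
  calc ∑ j, eev D B j = (Uᴴ * B * U).trace := Finset.sum_congr rfl fun j _ => (hentry B j j).symm
    _ = B.trace := by rw [Matrix.trace_mul_comm, ← mul_assoc, hUU', one_mul]

lemma eev_one (j) : eev D 1 j = 1 := by
  simp [eev, D.orth]

lemma eev_mul_self (B : Op q N) (j) : eev D (B * H) j = D.E j * eev D B j := by
  rw [eev, ← Matrix.mulVec_mulVec, D.eigH, Matrix.mulVec_smul, dotProduct_smul, smul_eq_mul, eev]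

lemma eev_sum {ι : Type*} (s : Finset ι) (B : ι → Op q N) (j) :
    eev D (∑ i ∈ s, B i) j = ∑ i ∈ s, eev D (B i) j := by
  simp only [eev, Matrix.sum_mulVec, dotProduct_sum]

lemma eev_Tmat_conj (B : Op q N) (j) :
    eev D (Tmat q N * B * (Tmat q N)ᴴ) j = eev D B j := by
  have hTT : (Tmat q N)ᴴ * Tmat q N = 1 := mul_eq_one_comm.mp Tmat_mul_conjTranspose
  have hstar : ∀ u w : (Fin N → Fin q) → ℂ,
      star u ⬝ᵥ Tmat q N *ᵥ w = star ((Tmat q N)ᴴ *ᵥ u) ⬝ᵥ w := fun u w => by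
    rw [Matrix.star_mulVec, Matrix.conjTranspose_conjTranspose, Matrix.dotProduct_mulVec]
  have hv : D.v j = D.τ j • (Tmat q N)ᴴ *ᵥ D.v j := by
    rw [← Matrix.mulVec_smul, ← D.eigT, Matrix.mulVec_mulVec, hTT, Matrix.one_mulVec]
  have hτ : star (D.τ j) * D.τ j = 1 := by
    have h1 : star (D.v j) ⬝ᵥ D.v j = 1 := by simp [D.orth]
    have h2 : star (Tmat q N *ᵥ D.v j) ⬝ᵥ Tmat q N *ᵥ D.v j = 1 := by
      rw [hstar, Matrix.mulVec_mulVec, hTT, Matrix.one_mulVec, h1]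
    rw [D.eigT, star_smul, smul_dotProduct, dotProduct_smul, h1] at h2
    simpa using h2
  have hv' : (Tmat q N)ᴴ *ᵥ D.v j = star (D.τ j) • D.v j := by
    conv_rhs => rw [hv, smul_smul, hτ, one_smul]
  rw [eev, mul_assoc, ← Matrix.mulVec_mulVec, hstar, ← Matrix.mulVec_mulVec, hv', star_smul,
    Matrix.mulVec_smul, smul_dotProduct, dotProduct_smul, eev, smul_smul, star_star, mul_comm, hτ,
    one_smul]

lemma eev_Tmat_pow_conj (B : Op q N) (l : ℕ) (j) :
    eev D (Tmat q N ^ l * B * (Tmat q N)ᴴ ^ l) j = eev D B j := by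
  induction l with
  | zero => simp
  | succ l ih =>
    rw [← ih, ← eev_Tmat_conj D (Tmat q N ^ l * B * (Tmat q N)ᴴ ^ l), pow_succ', pow_succ]
    simp only [mul_assoc]

end Eigenbasis

section Moments

variable {q k N : ℕ} {h : Op q k} (D : EigData q N (Ham q k N h))

lemma energy_eq (j) : (D.E j : ℂ) = N * eev D (embed q k N h) j := by
  have h1 := eev_mul_self D 1 j
  rw [eev_one, mul_one, one_mul] at h1
  have h2 : eev D (Ham q k N h) j =
      ∑ l : Fin N, eev D (Tmat q N ^ (l : ℕ) * embed q k N h * (Tmat q N)ᴴ ^ (l : ℕ)) j :=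
    eev_sum D Finset.univ _ j
  rw [← h1, h2]
  simp only [eev_Tmat_pow_conj]
  simp

lemma abs_energy_le (hkN : k ≤ N) (hnorm : ‖h‖ ≤ 1) (j) : |D.E j| ≤ N := by
  have h1 : ‖eev D (embed q k N h) j‖ ≤ 1 := by
    refine (norm_star_dotProduct_mulVec_le _ (by simp [D.orth])).trans ?_
    rw [embed_eq_place hkN]
    exact (norm_place_le _ _).trans hnorm
  have h2 := congrArg norm (energy_eq D j)
  rw [Complex.norm_real, norm_mul, Complex.norm_natCast, Real.norm_eq_abs] at h2
  rw [h2]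
  exact mul_le_of_le_one_right (Nat.cast_nonneg N) h1

lemma sum_energy_mul_eev (B : Op q N) :
    ∑ j, (D.E j : ℂ) * eev D B j = (Ham q k N h * B).trace := by
  rw [Matrix.trace_mul_comm, ← sum_eev D]
  simp only [eev_mul_self]

lemma sum_energy (hkN : k ≤ N) (htr : h.trace = 0) : ∑ j, (D.E j : ℂ) = 0 := by
  simp only [energy_eq, ← Finset.mul_sum]
  rw [sum_eev, embed_eq_place hkN, trace_place_eq_zero _ htr, mul_zero]

lemma sum_energy_sq :
    ∑ j, (D.E j : ℂ) ^ 2 = N * (Ham q k N h * embed q k N h).trace := by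
  rw [← sum_energy_mul_eev D, Finset.mul_sum]
  refine Finset.sum_congr rfl fun j _ => ?_
  rw [sq]
  nth_rewrite 2 [energy_eq D j]
  ring

lemma sum_energy_pow_four_le (hkN : k ≤ N) (htr : h.trace = 0) (hnorm : ‖h‖ ≤ 1) :
    ∑ j, D.E j ^ 4 ≤ 7 * ((k : ℝ) ^ 2) ^ 2 * (N : ℝ) ^ 2 * (q : ℝ) ^ N := by
  refine le_trans ?_ (norm_trace_Ham_pow_four_le (N := N) hkN htr hnorm)
  have h1 : ((∑ j, D.E j ^ 4 : ℝ) : ℂ) =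
      (Ham q k N h * (Ham q k N h * (Ham q k N h * Ham q k N h))).trace := by
    rw [← sum_eev D]
    push_cast
    refine Finset.sum_congr rfl fun j => ?_
    have := eev_mul_self D 1 j
    simp only [← mul_assoc, eev_mul_self]
    rw [one_mul, eev_one] at this
    rw [this]
    intro
    ring
  rw [← h1, Complex.norm_real]
  exact le_abs_self _

open scoped ComplexOrder in
lemma Ham_eq_zero_of_sum_energy_sq (h0 : ∑ j, D.E j ^ 2 = 0) : Ham q k N h = 0 := by
  have hE : ∀ j, D.E j = 0 := fun j => by
    simpa using (Finset.sum_eq_zero_iff_of_nonneg fun j _ => sq_nonneg (D.E j)).mp h0 j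
  have h1 : ((Ham q k N h)ᴴ * Ham q k N h).trace = 0 := by
    rw [← sum_eev D]
    simp [eev_mul_self, hE]
  exact Matrix.trace_conjTranspose_mul_self_eq_zero_iff.mp h1

end Moments

section Taylor

lemma norm_sub_deriv_mul_le {ι : Type*} [Fintype ι] {E : ι → ℝ} {a : ι → ℂ} {f : ℝ → ℂ}
    {c0 c1 c2 tA : ℂ} {M n d t C : ℝ} (hf : SmoothFn f c0 c1 c2 M) (hn : 0 < n) (hd : 0 < d)
    (hC : 0 ≤ C) (hE : ∀ j, |E j| ≤ n) (hE1 : ∑ j, (E j : ℂ) = 0)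
    (hE2 : ∑ j, E j ^ 2 = n * d * t) (hE4 : ∑ j, E j ^ 4 ≤ C * n ^ 2 * d)
    (hEa : ∑ j, (E j : ℂ) * a j = tA * d) :
    ‖tA - c1 * t‖ ≤ √t * (√n * √(1 / d * ∑ j, ‖a j - f (E j / n)‖ ^ 2)) +
      ‖c2 / 2‖ * (√t * √C) / √n + M * C / n := by
  obtain ⟨hM, -, hf⟩ := hf
  have hnC : (n : ℂ) ≠ 0 := Complex.ofReal_ne_zero.mpr hn.ne'
  set g : ι → ℂ := fun j =>
    f (E j / n) - c0 - c1 * (E j / n : ℝ) - c2 / 2 * (E j / n : ℝ) ^ 2 with hg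
  have hsplit : (tA - c1 * t) * d = ∑ j, (E j : ℂ) * (a j - f (E j / n)) + ∑ j, (E j : ℂ) * g j +
      c2 / 2 * ∑ j, (E j : ℂ) * (E j / n : ℝ) ^ 2 := by
    have hE2' : ∑ j, (E j : ℂ) ^ 2 = n * d * t := by exact_mod_cast hE2
    have h1 : ∑ j, (E j : ℂ) * (a j - f (E j / n)) + ∑ j, (E j : ℂ) * g j +
        c2 / 2 * ∑ j, (E j : ℂ) * (E j / n : ℝ) ^ 2 =
        ∑ j, (E j : ℂ) * a j - c0 * ∑ j, (E j : ℂ) - c1 / n * ∑ j, (E j : ℂ) ^ 2 := by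
      simp only [Finset.mul_sum, ← Finset.sum_add_distrib, ← Finset.sum_sub_distrib]
      refine Finset.sum_congr rfl fun j _ => ?_
      simp only [hg]
      push_cast
      ring
    rw [h1, hEa, hE1, hE2']
    field_simp
    ring
  have hx : ∀ j, E j / n ∈ Set.Icc (-1 : ℝ) 1 := fun j => by
    rw [Set.mem_Icc, ← abs_le, abs_div, abs_of_pos hn]
    exact (div_le_one hn).mpr (hE j)
  have hfst : ‖∑ j, (E j : ℂ) * (a j - f (E j / n))‖ ≤
      d * (√t * (√n * √(1 / d * ∑ j, ‖a j - f (E j / n)‖ ^ 2))) := by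
    set Q := ∑ j, ‖a j - f (E j / n)‖ ^ 2 with hQ
    calc ‖∑ j, (E j : ℂ) * (a j - f (E j / n))‖
        ≤ ∑ j, |E j| * ‖a j - f (E j / n)‖ :=
          (norm_sum_le _ _).trans_eq (by simp)
      _ ≤ √(∑ j, |E j| ^ 2) * √Q := Real.sum_mul_le_sqrt_mul_sqrt _ _ _
      _ = √(n * d * t) * √(d * (1 / d * Q)) := by
          simp only [sq_abs, hE2]
          congr 2
          field_simp
      _ = (√d * √d) * (√t * (√n * √(1 / d * Q))) := by
          rw [Real.sqrt_mul (by positivity), Real.sqrt_mul hn.le, Real.sqrt_mul hd.le]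
          ring
      _ = _ := by rw [Real.mul_self_sqrt hd.le]
  have hsnd : ‖∑ j, (E j : ℂ) * g j‖ ≤ d * (M * C / n) := by
    calc ‖∑ j, (E j : ℂ) * g j‖ ≤ ∑ j, |E j| * ‖g j‖ := (norm_sum_le _ _).trans_eq (by simp)
      _ ≤ ∑ j, M / n ^ 3 * E j ^ 4 := by
          refine Finset.sum_le_sum fun j _ => ?_
          calc |E j| * ‖g j‖ ≤ |E j| * (M * |E j / n| ^ 3) := by
                gcongr
                exact hf _ (hx j)
            _ = M / n ^ 3 * E j ^ 4 := by
                rw [abs_div, abs_of_pos hn, div_pow, ← Even.pow_abs (by decide : Even 4) (E j)]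
                ring
      _ ≤ M / n ^ 3 * (C * n ^ 2 * d) := by
          rw [← Finset.mul_sum]
          gcongr
      _ = d * (M * C / n) := by field_simp
  have hthd : ‖c2 / 2 * ∑ j, (E j : ℂ) * (E j / n : ℝ) ^ 2‖ ≤ d * (‖c2 / 2‖ * (√t * √C) / √n) := by
    have h1 : ‖∑ j, (E j : ℂ) * (E j / n : ℝ) ^ 2‖ ≤ 1 / n ^ 2 * ∑ j, |E j| * E j ^ 2 := by
      refine (norm_sum_le _ _).trans_eq ?_
      rw [Finset.mul_sum]
      refine Finset.sum_congr rfl fun j _ => ?_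
      rw [norm_mul, norm_pow, Complex.norm_real, Complex.norm_real, Real.norm_eq_abs,
        Real.norm_eq_abs, sq_abs]
      ring
    have h2 : ∑ j, |E j| * E j ^ 2 ≤ √(n * d * t) * √(C * n ^ 2 * d) := by
      refine (Real.sum_mul_le_sqrt_mul_sqrt _ _ _).trans ?_
      simp only [sq_abs, hE2, ← pow_mul]
      gcongr
    have h3 : 1 / n ^ 2 * (√(n * d * t) * √(C * n ^ 2 * d)) = d * ((√t * √C) / √n) := by
      rw [Real.sqrt_mul (by positivity), Real.sqrt_mul hn.le, Real.sqrt_mul (by positivity),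
        Real.sqrt_mul hC, Real.sqrt_sq hn.le]
      have hsn : √n ≠ 0 := (Real.sqrt_pos.mpr hn).ne'
      have hnn : √n ^ 2 = n := Real.sq_sqrt hn.le
      have hdd : √d ^ 2 = d := Real.sq_sqrt hd.le
      field_simp
      rw [hnn, hdd]
      ring
    calc ‖c2 / 2 * ∑ j, (E j : ℂ) * (E j / n : ℝ) ^ 2‖
        ≤ ‖c2 / 2‖ * (1 / n ^ 2 * (√(n * d * t) * √(C * n ^ 2 * d))) := by
          rw [norm_mul]
          gcongr
          exact h1.trans (by gcongr)
      _ = _ := by rw [h3]; ring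
  have hfin := norm_add₃_le (a := ∑ j, (E j : ℂ) * (a j - f (E j / n)))
    (b := ∑ j, (E j : ℂ) * g j) (c := c2 / 2 * ∑ j, (E j : ℂ) * (E j / n : ℝ) ^ 2)
  rw [← hsplit, norm_mul, Complex.norm_real, Real.norm_eq_abs, abs_of_pos hd] at hfin
  refine le_of_mul_le_mul_right ?_ hd
  linarith

end Taylor

end QuditChain

/-- If `A` is traceless with `‖A‖ = 1`, `f` is smooth, the Hamiltonian is
nonzero for arbitrarily large system sizes, and `√(N_i) r_f(N_i) → 0` along a strictly
increasing sequence `N_i`, then `f'(0) = tr(H_N A)/tr(H_N h)` (for all large `N`). -/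
theorem taylor_first_deriv (dloc k k' : ℕ) (hdloc : 2 ≤ dloc) (hk : 1 ≤ k)
    (h : Op dloc k) (hherm : h.IsHermitian) (htr : h.trace = 0) (hnorm : opNorm h = 1)
    (D : ∀ N, EigData dloc N (Ham dloc k N h))
    (hH : ∀ N₀ : ℕ, ∃ N : ℕ, N₀ ≤ N ∧ Ham dloc k N h ≠ 0)
    (A : Op dloc k') (hAtr : A.trace = 0) (hAnorm : opNorm A = 1)
    (f : ℝ → ℂ) (c0 c1 c2 : ℂ) (M : ℝ) (hf : SmoothFn f c0 c1 c2 M)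
    (Ni : ℕ → ℕ) (hmono : StrictMono Ni)
    (hlim : Filter.Tendsto
      (fun i => Real.sqrt (Ni i) * rf (D (Ni i)) (embed dloc k' (Ni i) A) f)
      Filter.atTop (nhds 0)) :
    ∃ N₀ : ℕ, ∀ N : ℕ, N₀ ≤ N →
      c1 = (Ham dloc k N h * embed dloc k' N A).trace /
        (Ham dloc k N h * embed dloc k N h).trace := by
  have hq0 : dloc ≠ 0 := by omega
  have hnorm' : Norm.norm (self := (Matrix.instL2OpNormedAddCommGroup).toNorm) h ≤ 1 := hnorm.le
  obtain ⟨tA, htA⟩ := QuditChain.trace_Ham_mul_embed hq0 h htr A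
  obtain ⟨th, hth⟩ := QuditChain.trace_Ham_mul_embed hq0 h htr h
  set C : ℝ := 7 * ((k : ℝ) ^ 2) ^ 2
  have hC0 : 0 ≤ C := by positivity
  have hqN : ∀ N, (0 : ℝ) < (dloc : ℝ) ^ N := fun N => by positivity
  have hsq : ∀ N, 2 * k + k ≤ N → ∑ j, (D N).E j ^ 2 = N * (dloc : ℝ) ^ N * th.re ∧
      (th.im = 0) := by
    intro N hN
    have hNpos : (0 : ℝ) < N := by exact_mod_cast (by omega : 0 < N)
    have h1 := QuditChain.sum_energy_sq (D N)
    rw [hth N hN] at h1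
    have h2 : ((∑ j, (D N).E j ^ 2 : ℝ) : ℂ) = ((N * (dloc : ℝ) ^ N : ℝ) : ℂ) * th := by
      push_cast
      rw [h1]
      ring
    have hre := congrArg Complex.re h2
    have him := congrArg Complex.im h2
    rw [Complex.re_ofReal_mul, Complex.ofReal_re] at hre
    rw [Complex.im_ofReal_mul, Complex.ofReal_im] at him
    exact ⟨hre, (mul_eq_zero.mp him.symm).resolve_left (mul_pos hNpos (hqN N)).ne'⟩
  have hthreal : (th.re : ℂ) = th := Complex.ext rfl (by simp [(hsq _ le_rfl).2])
  have hth0 : 0 < th.re := by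
    obtain ⟨N, hN, hHN⟩ := hH (2 * k + k)
    have hNpos : (0 : ℝ) < N := by exact_mod_cast (by omega : 0 < N)
    have h1 := (hsq N hN).1
    have h2 : 0 < ∑ j, (D N).E j ^ 2 :=
      lt_of_le_of_ne (Finset.sum_nonneg fun j _ => sq_nonneg _)
        fun h0 => hHN (QuditChain.Ham_eq_zero_of_sum_energy_sq (D N) h0.symm)
    rw [h1] at h2
    exact (mul_pos_iff_of_pos_left (mul_pos hNpos (hqN N))).mp h2
  have hbound : ∀ N, 2 * k + k ≤ N → 2 * k + k' ≤ N → ‖tA - c1 * th.re‖ ≤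
      √th.re * (√N * rf (D N) (embed dloc k' N A) f) +
        ‖c2 / 2‖ * (√th.re * √C) / √N + M * C / N := by
    intro N hN hN'
    have hkN : k ≤ N := by omega
    have hNpos : (0 : ℝ) < N := by exact_mod_cast (by omega : 0 < N)
    refine QuditChain.norm_sub_deriv_mul_le hf hNpos (hqN N) hC0
      (QuditChain.abs_energy_le (D N) hkN hnorm') (QuditChain.sum_energy (D N) hkN htr)
      (hsq N hN).1 (QuditChain.sum_energy_pow_four_le (D N) hkN htr hnorm') ?_
    rw [QuditChain.sum_energy_mul_eev, htA N hN']
    push_cast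
    rfl
  have hNi : Tendsto (fun i => (Ni i : ℝ)) atTop atTop :=
    tendsto_natCast_atTop_atTop.comp hmono.tendsto_atTop
  have hlim0 : Tendsto (fun i => √th.re * (√(Ni i) * rf (D (Ni i)) (embed dloc k' (Ni i) A) f) +
      ‖c2 / 2‖ * (√th.re * √C) / √(Ni i) + M * C / Ni i) atTop (nhds 0) := by
    have h1 := hlim.const_mul (√th.re)
    have h2 := (Real.tendsto_sqrt_atTop.comp hNi).const_div_atTop (‖c2 / 2‖ * (√th.re * √C))
    have h3 := hNi.const_div_atTop (M * C)
    simpa using (h1.add h2).add h3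
  have hzero : ‖tA - c1 * th.re‖ ≤ 0 := by
    refine ge_of_tendsto hlim0 ?_
    filter_upwards [hmono.tendsto_atTop.eventually_ge_atTop (2 * k + k),
      hmono.tendsto_atTop.eventually_ge_atTop (2 * k + k')] with i hi hi'
    exact hbound _ hi hi'
  have hval : tA = c1 * th := by
    rw [← hthreal]
    exact sub_eq_zero.mp (norm_le_zero_iff.mp hzero)
  have hthne : th ≠ 0 := by
    rw [← hthreal]
    exact Complex.ofReal_ne_zero.mpr hth0.ne'
  refine ⟨2 * k + k + k', fun N hN => ?_⟩
  have hqN' : (dloc : ℂ) ^ N ≠ 0 := pow_ne_zero _ (Nat.cast_ne_zero.mpr hq0)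
  rw [htA N (by omega), hth N (by omega), hval]
  field_simp
end

section
/- Let A be a traceless operator on the first k' sites with ‖A‖ = 1, let f : [−1,1] → {z ∈ ℂ : |z| ≤ 1} be a smooth function, and suppose H_N ≠ 0 for some sufficiently large N, so that tr(H_N h)/d is a positive N-independent constant for large N. If there exists a strictly increasing sequence (N_i) of positive integers such that N_i · r_f(N_i) → 0 as i → ∞, then f''(0) = 0. -/
open Matrix MeasureTheory Filter

section SiteEmbed

set_option linter.unusedSectionVars false

variable {ι κ μ α : Type*} [Fintype ι] [DecidableEq ι] [Fintype κ] [DecidableEq κ]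
  [Fintype μ] [DecidableEq μ] [Fintype α] [DecidableEq α]

open Classical in
/-- The operator acting as `a` on the sites in the range of `φ` and as the identity elsewhere. -/
noncomputable def siteEmbed (φ : κ → ι) (a : Matrix (κ → α) (κ → α) ℂ) :
    Matrix (ι → α) (ι → α) ℂ :=
  fun x y => a (x ∘ φ) (y ∘ φ) * if ∀ i ∉ Set.range φ, x i = y i then 1 else 0

open Classical in
lemma sum_comp_of_eq_off_range {φ : κ → ι} (hφ : φ.Injective) (F : (κ → α) → ℂ) (x : ι → α) :
    ∑ y : ι → α, F (y ∘ φ) * (if ∀ i ∉ Set.range φ, x i = y i then 1 else 0) = ∑ u, F u := by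
  symm
  refine Fintype.sum_of_injective (fun u => Function.extend φ u x) ?_ _ _ ?_ ?_
  · intro u v huv
    have := congrArg (fun y => y ∘ φ) huv
    simpa [Function.extend_comp hφ] using this
  · intro y hy
    rw [if_neg, mul_zero]
    intro hxy
    refine hy ⟨y ∘ φ, ?_⟩
    funext i
    by_cases hi : i ∈ Set.range φ
    · obtain ⟨j, rfl⟩ := hi
      simp [hφ.extend_apply]
    · simp only
      rw [Function.extend_apply' _ _ _ (by simpa using hi), hxy i hi]
  · intro u
    rw [if_pos, mul_one, Function.extend_comp hφ]
    intro i hi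
    rw [Function.extend_apply' _ _ _ (by simpa using hi)]

lemma siteEmbed_one {φ : κ → ι} :
    siteEmbed φ (1 : Matrix (κ → α) (κ → α) ℂ) = 1 := by
  ext x y
  simp only [siteEmbed, Matrix.one_apply]
  by_cases hxy : x = y
  · simp [hxy]
  · rw [if_neg hxy]
    by_cases h1 : x ∘ φ = y ∘ φ
    · rw [if_neg (c := ∀ i ∉ Set.range φ, x i = y i), mul_zero]
      intro h2
      apply hxy
      funext i
      by_cases hi : i ∈ Set.range φ
      · obtain ⟨j, rfl⟩ := hi
        exact congrFun h1 j
      · exact h2 i hi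
    · rw [if_neg h1, zero_mul]

lemma siteEmbed_mul {φ : κ → ι} (hφ : φ.Injective) (a b : Matrix (κ → α) (κ → α) ℂ) :
    siteEmbed φ (a * b) = siteEmbed φ a * siteEmbed φ b := by
  classical
  ext x z
  simp only [siteEmbed, Matrix.mul_apply]
  rw [← sum_comp_of_eq_off_range hφ (fun u => a (x ∘ φ) u * b u (z ∘ φ)) x, Finset.sum_mul]
  refine Finset.sum_congr rfl fun y _ => ?_
  by_cases hxy : ∀ i ∉ Set.range φ, x i = y i
  · have : (∀ i ∉ Set.range φ, x i = z i) ↔ (∀ i ∉ Set.range φ, y i = z i) :=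
      forall₂_congr fun i hi => by rw [hxy i hi]
    simp only [this, if_pos hxy]
    ring
  · simp only [if_neg hxy]
    ring

/-- The embedding of a set of sites as a unital star homomorphism between operator algebras. -/
noncomputable def siteEmbedHom (φ : κ → ι) (hφ : φ.Injective) :
    Matrix (κ → α) (κ → α) ℂ →⋆ₐ[ℂ] Matrix (ι → α) (ι → α) ℂ where
  toFun := siteEmbed φ
  map_one' := siteEmbed_one
  map_mul' := siteEmbed_mul hφ
  map_zero' := by ext; simp [siteEmbed]
  map_add' a b := by ext; simp only [siteEmbed, Matrix.add_apply, add_mul]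
  commutes' r := by
    rw [Algebra.algebraMap_eq_smul_one, Algebra.algebraMap_eq_smul_one,
      ← siteEmbed_one (φ := φ)]
    ext
    simp [siteEmbed]
  map_star' a := by
    ext x y
    simp only [siteEmbed, Matrix.star_apply, star_mul']
    congr 1
    have : (∀ i ∉ Set.range φ, x i = y i) ↔ (∀ i ∉ Set.range φ, y i = x i) :=
      forall₂_congr fun i hi => eq_comm
    simp only [this]
    split_ifs <;> simp

open scoped Matrix.Norms.L2Operator in
lemma norm_siteEmbed_le {φ : κ → ι} (hφ : φ.Injective) (a : Matrix (κ → α) (κ → α) ℂ) :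
    ‖siteEmbed φ a‖ ≤ ‖a‖ :=
  NonUnitalStarAlgHom.norm_apply_le (siteEmbedHom φ hφ) a

lemma siteEmbed_siteEmbed {φ : κ → ι} {ψ : ι → μ} (hψ : ψ.Injective)
    (a : Matrix (κ → α) (κ → α) ℂ) :
    siteEmbed ψ (siteEmbed φ a) = siteEmbed (ψ ∘ φ) a := by
  ext x y
  simp only [siteEmbed, mul_assoc]
  congr 1
  rw [ite_zero_mul_ite_zero, mul_one]
  refine if_congr ?_ rfl rfl
  constructor
  · rintro ⟨h1, h2⟩ i hi
    by_cases hi' : i ∈ Set.range ψ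
    · obtain ⟨j, rfl⟩ := hi'
      refine h1 j fun ⟨l, hl⟩ => hi ⟨l, by simp [hl]⟩
    · exact h2 i hi'
  · intro h1
    refine ⟨fun j hj => h1 (ψ j) ?_, fun i hi => h1 i ?_⟩
    · rintro ⟨l, hl⟩
      exact hj ⟨l, hψ hl⟩
    · rintro ⟨l, rfl⟩
      exact hi ⟨φ l, rfl⟩

lemma siteEmbed_submatrix {φ : κ → ι} (e : Equiv.Perm ι) (a : Matrix (κ → α) (κ → α) ℂ) :
    (siteEmbed φ a).submatrix (fun x => x ∘ e) (fun x => x ∘ e) = siteEmbed (e ∘ φ) a := by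
  ext x y
  simp only [siteEmbed, Matrix.submatrix_apply, Function.comp_assoc]
  congr 1
  refine if_congr ?_ rfl rfl
  constructor
  · intro h i hi
    have := h (e.symm i) fun ⟨j, hj⟩ => hi ⟨j, by simp [hj]⟩
    simpa using this
  · intro h i hi
    exact h (e i) fun ⟨j, hj⟩ => hi ⟨j, e.injective hj⟩

open Classical in
lemma siteEmbed_mul_siteEmbed_apply {φ : κ → ι} {ψ : μ → ι}
    (hd : Disjoint (Set.range φ) (Set.range ψ)) (a : Matrix (κ → α) (κ → α) ℂ)
    (b : Matrix (μ → α) (μ → α) ℂ) (x z : ι → α) :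
    (siteEmbed φ a * siteEmbed ψ b) x z = a (x ∘ φ) (z ∘ φ) * b (x ∘ ψ) (z ∘ ψ) *
      if ∀ i, i ∉ Set.range φ → i ∉ Set.range ψ → x i = z i then 1 else 0 := by
  rw [Matrix.mul_apply,
    Finset.sum_eq_single_of_mem (fun i => if i ∈ Set.range φ then z i else x i)
      (Finset.mem_univ _)]
  · have h1 : (fun i => if i ∈ Set.range φ then z i else x i) ∘ φ = z ∘ φ := by
      funext j
      simp
    have h2 : (fun i => if i ∈ Set.range φ then z i else x i) ∘ ψ = x ∘ ψ := by
      funext j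
      have : ψ j ∉ Set.range φ := fun h => Set.disjoint_left.1 hd h ⟨j, rfl⟩
      simp only [Function.comp_apply, if_neg this]
    simp only [siteEmbed, h1, h2]
    rw [if_pos (c := ∀ i ∉ Set.range φ, x i = _) (by intro i hi; rw [if_neg hi])]
    have h3 : (∀ i ∉ Set.range ψ, (if i ∈ Set.range φ then z i else x i) = z i) ↔
        ∀ i, i ∉ Set.range φ → i ∉ Set.range ψ → x i = z i := by
      constructor
      · intro h i h1 h2
        have := h i h2
        rwa [if_neg h1] at this
      · intro h i h2
        by_cases h1 : i ∈ Set.range φ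
        · rw [if_pos h1]
        · rw [if_neg h1, h i h1 h2]
    simp only [h3]
    ring
  · intro y _ hy
    simp only [siteEmbed]
    by_cases h1 : ∀ i ∉ Set.range φ, x i = y i
    · rw [if_neg (c := ∀ i ∉ Set.range ψ, y i = z i), mul_zero, mul_zero]
      intro h2
      apply hy
      funext i
      by_cases hi : i ∈ Set.range φ
      · rw [if_pos hi, h2 i (Set.disjoint_left.1 hd hi)]
      · rw [if_neg hi, h1 i hi]
    · rw [if_neg h1, mul_zero, zero_mul]

lemma siteEmbed_commute {φ : κ → ι} {ψ : μ → ι}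
    (hd : Disjoint (Set.range φ) (Set.range ψ)) (a : Matrix (κ → α) (κ → α) ℂ)
    (b : Matrix (μ → α) (μ → α) ℂ) : Commute (siteEmbed φ a) (siteEmbed ψ b) := by
  classical
  ext x z
  rw [siteEmbed_mul_siteEmbed_apply hd, siteEmbed_mul_siteEmbed_apply hd.symm]
  have : (∀ i, i ∉ Set.range φ → i ∉ Set.range ψ → x i = z i) ↔
      ∀ i, i ∉ Set.range ψ → i ∉ Set.range φ → x i = z i :=
    forall_congr' fun i => Imp.swap
  simp only [this]
  ring

end SiteEmbed

/-- A tracial linear functional on a full matrix algebra is proportional to the trace. -/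
lemma Matrix.card_mul_eq_trace_mul_of_tracial {n : Type*} [Fintype n] [DecidableEq n]
    (L : Matrix n n ℂ →ₗ[ℂ] ℂ) (hL : ∀ a b, L (a * b) = L (b * a)) (a : Matrix n n ℂ) :
    Fintype.card n * L a = a.trace * L 1 := by
  have key : ∑ i : n, ∑ j : n, single i j (1 : ℂ) * a * single j i 1 = a.trace • 1 := by
    have (i j : n) : single i j (1 : ℂ) * a * single j i 1 = single i i (a j j) := by
      simp
    simp only [this]
    ext x y
    simp [Matrix.sum_apply, Matrix.single_apply, Matrix.one_apply, Matrix.trace, ite_and]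
  have h2 : ∑ j : n, single j j (1 : ℂ) = 1 := by
    ext x y
    simp [Matrix.sum_apply, Matrix.single_apply, Matrix.one_apply, ite_and]
  have h3 := congrArg L key
  simp only [map_sum, map_smul, smul_eq_mul] at h3
  rw [← h3]
  have (i j : n) : L (single i j (1 : ℂ) * a * single j i 1) = L (a * single j j 1) := by
    rw [mul_assoc, hL, mul_assoc]
    simp
  simp only [this, Finset.sum_const, Finset.card_univ, nsmul_eq_mul]
  rw [← map_sum, ← Finset.mul_sum, h2, mul_one]

section SiteEmbedTrace

variable {ι κ α : Type*} [Fintype ι] [DecidableEq ι] [Fintype κ] [DecidableEq κ]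
  [Fintype α] [DecidableEq α]

lemma card_mul_trace_siteEmbed_mul {φ : κ → ι} (hφ : φ.Injective)
    {Y : Matrix (ι → α) (ι → α) ℂ} (hY : ∀ b, Commute (siteEmbed φ b) Y)
    (a : Matrix (κ → α) (κ → α) ℂ) :
    Fintype.card (κ → α) * (siteEmbed φ a * Y).trace = a.trace * Y.trace := by
  have := Matrix.card_mul_eq_trace_mul_of_tracial
    ((Matrix.traceLinearMap (ι → α) ℂ ℂ) ∘ₗ (LinearMap.mulRight ℂ Y) ∘ₗ
      (siteEmbedHom φ hφ).toAlgHom.toLinearMap) (fun a b => by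
        simp only [LinearMap.comp_apply, AlgHom.toLinearMap_apply, map_mul,
          LinearMap.mulRight_apply, Matrix.traceLinearMap_apply]
        change (siteEmbed φ a * siteEmbed φ b * Y).trace =
          (siteEmbed φ b * siteEmbed φ a * Y).trace
        rw [mul_assoc, (hY b).eq, ← mul_assoc, Matrix.trace_mul_comm, mul_assoc]) a
  simp only [LinearMap.comp_apply, AlgHom.toLinearMap_apply, map_one,
    LinearMap.mulRight_apply, Matrix.traceLinearMap_apply, one_mul] at this
  exact this

lemma trace_siteEmbed_mul_eq_zero [Nonempty α] {φ : κ → ι} (hφ : φ.Injective)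
    {Y : Matrix (ι → α) (ι → α) ℂ} (hY : ∀ b, Commute (siteEmbed φ b) Y)
    {a : Matrix (κ → α) (κ → α) ℂ} (ha : a.trace = 0) :
    (siteEmbed φ a * Y).trace = 0 := by
  have := card_mul_trace_siteEmbed_mul hφ hY a
  rw [ha, zero_mul] at this
  exact (mul_eq_zero.1 this).resolve_left (Nat.cast_ne_zero.2 Fintype.card_ne_zero)

lemma card_mul_trace_siteEmbed {φ : κ → ι} (hφ : φ.Injective)
    (a : Matrix (κ → α) (κ → α) ℂ) :
    Fintype.card (κ → α) * (siteEmbed φ a).trace = a.trace * Fintype.card (ι → α) := by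
  simpa using card_mul_trace_siteEmbed_mul hφ (fun b => Commute.one_right _) a

end SiteEmbedTrace

section Chain

set_option linter.unusedSectionVars false

variable {dloc m N : ℕ}

lemma embed_eq_siteEmbed (hm : m ≤ N) (a : Op dloc m) :
    embed dloc m N a = siteEmbed (Fin.castLE hm) a := by
  refine (dif_pos hm).trans ?_
  funext x y
  refine congrArg₂ _ rfl (@if_congr _ _ _ (_) (_) _ _ _ _ ?_ rfl rfl)
  simp [Fin.range_castLE]

lemma Tmat_mul_mul_conjTranspose (X : Op dloc N) :
    Tmat dloc N * X * (Tmat dloc N)ᴴ =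
      X.submatrix (fun x => x ∘ finRotate N) (fun x => x ∘ finRotate N) := by
  have hT (x y : Fin N → Fin dloc) : Tmat dloc N x y = if y = x ∘ finRotate N then 1 else 0 := by
    have : x = confShift dloc N y ↔ y = x ∘ finRotate N := by
      rw [← Equiv.symm_apply_eq, eq_comm]
      rfl
    simp only [Tmat, this]
  ext x y
  simp [Matrix.mul_apply, hT, apply_ite]

lemma Tmat_pow_conj (X : Op dloc N) (l : ℕ) :
    Tmat dloc N ^ l * X * (Tmat dloc N)ᴴ ^ l =
      X.submatrix (fun x => x ∘ (finRotate N ^ l : Equiv.Perm (Fin N)))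
        (fun x => x ∘ (finRotate N ^ l : Equiv.Perm (Fin N))) := by
  induction l with
  | zero => ext x y; simp
  | succ l ih =>
    have : Tmat dloc N ^ (l + 1) * X * (Tmat dloc N)ᴴ ^ (l + 1) =
        Tmat dloc N * (Tmat dloc N ^ l * X * (Tmat dloc N)ᴴ ^ l) * (Tmat dloc N)ᴴ := by
      rw [pow_succ', pow_succ]
      simp only [mul_assoc]
    rw [this, ih, Tmat_mul_mul_conjTranspose, Matrix.submatrix_submatrix, pow_succ']
    rfl

variable [NeZero N]

lemma val_finRotate_pow (l : ℕ) (i : Fin N) :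
    (((finRotate N ^ l : Equiv.Perm (Fin N)) i : Fin N) : ℕ) = (i + l) % N := by
  induction l with
  | zero => simp [Nat.mod_eq_of_lt i.isLt]
  | succ l ih =>
    rw [pow_succ', Equiv.Perm.mul_apply, finRotate_apply, Fin.val_add, ih, Fin.val_one']
    simp [add_assoc]

/-- The window of `m` consecutive sites starting at site `l` of a periodic chain. -/
def siteWindow (hm : m ≤ N) (l : Fin N) (i : Fin m) : Fin N := Fin.castLE hm i + l

lemma siteWindow_injective (hm : m ≤ N) (l : Fin N) : (siteWindow hm l).Injective :=
  (add_left_injective l).comp (Fin.castLE_injective hm)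

lemma Tmat_conj_embed (hm : m ≤ N) (a : Op dloc m) (l : Fin N) :
    Tmat dloc N ^ (l : ℕ) * embed dloc m N a * (Tmat dloc N)ᴴ ^ (l : ℕ) =
      siteEmbed (siteWindow hm l) a := by
  rw [Tmat_pow_conj, embed_eq_siteEmbed hm, siteEmbed_submatrix]
  congr 1
  funext i
  ext
  simp [val_finRotate_pow, siteWindow, Fin.val_add]

lemma Ham_eq_sum (hm : m ≤ N) (h : Op dloc m) :
    Ham dloc m N h = ∑ l : Fin N, siteEmbed (siteWindow hm l) h := by
  simp only [Ham, Tmat_conj_embed hm]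

open scoped Matrix.Norms.L2Operator in
lemma norm_Ham_le (hm : m ≤ N) (h : Op dloc m) : ‖Ham dloc m N h‖ ≤ N * ‖h‖ := by
  rw [Ham_eq_sum hm]
  refine (norm_sum_le _ _).trans ?_
  refine (Finset.sum_le_sum fun l _ => norm_siteEmbed_le (siteWindow_injective hm l) h).trans ?_
  simp

lemma trace_Ham [NeZero dloc] (hm : m ≤ N) {h : Op dloc m} (htr : h.trace = 0) :
    (Ham dloc m N h).trace = 0 := by
  rw [Ham_eq_sum hm, Matrix.trace_sum]
  refine Finset.sum_eq_zero fun l _ => ?_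
  simpa using trace_siteEmbed_mul_eq_zero (siteWindow_injective hm l)
    (fun b => Commute.one_right _) htr

/-- Two windows overlap on the periodic chain. -/
def WindowsMeet (hm : m ≤ N) (l l' : Fin N) : Prop :=
  ¬ Disjoint (Set.range (siteWindow hm l)) (Set.range (siteWindow hm l'))

lemma WindowsMeet.symm {hm : m ≤ N} {l l' : Fin N} (h : WindowsMeet hm l l') :
    WindowsMeet hm l' l :=
  fun hd => h hd.symm

open Classical in
lemma card_windowsMeet_le (hm : m ≤ N) (l : Fin N) :
    (Finset.univ.filter (WindowsMeet hm l)).card ≤ m ^ 2 := by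
  have : Finset.univ.filter (WindowsMeet hm l) ⊆ Finset.univ.image
      (fun p : Fin m × Fin m => Fin.castLE hm p.1 + l - Fin.castLE hm p.2) := by
    intro l' hl'
    rw [Finset.mem_filter, WindowsMeet, Set.not_disjoint_iff] at hl'
    obtain ⟨-, _, ⟨i, rfl⟩, j, hj⟩ := hl'
    refine Finset.mem_image.2 ⟨(i, j), Finset.mem_univ _, ?_⟩
    simp only [siteWindow] at hj
    rw [← hj, add_sub_cancel_left]
  refine (Finset.card_le_card this).trans (Finset.card_image_le.trans ?_)
  simp [sq]

lemma trace_mul_eq_zero_of_not_meet [NeZero dloc] (hm : m ≤ N) {h : Op dloc m}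
    (htr : h.trace = 0) {a b c e : Fin N} (hb : ¬ WindowsMeet hm a b)
    (hc : ¬ WindowsMeet hm a c) (he : ¬ WindowsMeet hm a e) :
    (siteEmbed (siteWindow hm a) h * (siteEmbed (siteWindow hm b) h *
      siteEmbed (siteWindow hm c) h * siteEmbed (siteWindow hm e) h)).trace = 0 := by
  refine trace_siteEmbed_mul_eq_zero (siteWindow_injective hm a) (fun x => ?_) htr
  have key {l : Fin N} (hl : ¬ WindowsMeet hm a l) :=
    siteEmbed_commute (not_not.1 hl) x h
  exact ((key hb).mul_right (key hc)).mul_right (key he)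

lemma norm_entry_le_opNorm {n : Type*} [Fintype n] [DecidableEq n] (X : Matrix n n ℂ)
    (i j : n) :
    ‖X i j‖ ≤ opNorm X := by
  have h1 := (Matrix.toEuclideanCLM (𝕜 := ℂ) X).le_opNorm (EuclideanSpace.single j 1)
  rw [PiLp.norm_single, norm_one, mul_one] at h1
  refine le_trans ?_ h1
  have h2 := PiLp.norm_apply_le (Matrix.toEuclideanCLM (𝕜 := ℂ) X (EuclideanSpace.single j 1)) i
  simpa [Matrix.ofLp_toEuclideanCLM] using h2

open scoped Matrix.Norms.L2Operator in
lemma norm_trace_le {n : Type*} [Fintype n] [DecidableEq n] (X : Matrix n n ℂ) :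
    ‖X.trace‖ ≤ Fintype.card n * ‖X‖ := by
  refine (norm_sum_le _ _).trans ?_
  refine (Finset.sum_le_sum fun i _ => norm_entry_le_opNorm X i i).trans ?_
  simp [opNorm, Matrix.cstar_norm_def]

/-- A quadruple whose first three windows each overlap another one contains two overlapping
pairs that leave at most two free positions. -/
lemma windowsMeet_cases {hm : m ≤ N} {a b c e : Fin N}
    (ha : WindowsMeet hm a b ∨ WindowsMeet hm a c ∨ WindowsMeet hm a e)
    (hb : WindowsMeet hm b c ∨ WindowsMeet hm b e ∨ WindowsMeet hm b a)
    (hc : WindowsMeet hm c e ∨ WindowsMeet hm c a ∨ WindowsMeet hm c b) :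
    (WindowsMeet hm a b ∧ WindowsMeet hm c e) ∨ (WindowsMeet hm a c ∧ WindowsMeet hm b e) ∨
    (WindowsMeet hm a e ∧ WindowsMeet hm b c) ∨ (WindowsMeet hm a b ∧ WindowsMeet hm a c) ∨
    (WindowsMeet hm b a ∧ WindowsMeet hm b c) ∨ (WindowsMeet hm c a ∧ WindowsMeet hm c b) ∨
    (WindowsMeet hm e a ∧ WindowsMeet hm e b) := by
  have s (l l' : Fin N) : WindowsMeet hm l l' ↔ WindowsMeet hm l' l := ⟨.symm, .symm⟩
  rw [s b a] at hb ⊢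
  rw [s c a, s c b] at hc ⊢
  rw [s e a, s e b]
  generalize WindowsMeet hm a b = p1, WindowsMeet hm a c = p2, WindowsMeet hm a e = p3,
    WindowsMeet hm b c = p4, WindowsMeet hm b e = p5, WindowsMeet hm c e = p6 at *
  clear s
  grind

open Classical in
lemma norm_trace_quadruple_le [NeZero dloc] (hm : m ≤ N) {h : Op dloc m} (htr : h.trace = 0)
    (hnorm : opNorm h = 1) (a b c e : Fin N) :
    ‖(siteEmbed (siteWindow hm a) h * (siteEmbed (siteWindow hm b) h *
      siteEmbed (siteWindow hm c) h * siteEmbed (siteWindow hm e) h)).trace‖ ≤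
    (dloc : ℝ) ^ N * (
      (if WindowsMeet hm a b ∧ WindowsMeet hm c e then 1 else 0) +
      (if WindowsMeet hm a c ∧ WindowsMeet hm b e then 1 else 0) +
      (if WindowsMeet hm a e ∧ WindowsMeet hm b c then 1 else 0) +
      (if WindowsMeet hm a b ∧ WindowsMeet hm a c then 1 else 0) +
      (if WindowsMeet hm b a ∧ WindowsMeet hm b c then 1 else 0) +
      (if WindowsMeet hm c a ∧ WindowsMeet hm c b then 1 else 0) +
      (if WindowsMeet hm e a ∧ WindowsMeet hm e b then 1 else 0)) := by
  open scoped Matrix.Norms.L2Operator in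
  set t : Fin N → Op dloc N := fun l => siteEmbed (siteWindow hm l) h
  change ‖(t a * (t b * t c * t e)).trace‖ ≤ _
  by_cases hz : (t a * (t b * t c * t e)).trace = 0
  · rw [hz, norm_zero]
    positivity
  have hcyc (a b c e : Fin N) :
      (t a * (t b * t c * t e)).trace = (t b * (t c * t e * t a)).trace := by
    rw [Matrix.trace_mul_comm]
    simp only [mul_assoc]
  have hmeet (a b c e : Fin N) (hz : (t a * (t b * t c * t e)).trace ≠ 0) :
      WindowsMeet hm a b ∨ WindowsMeet hm a c ∨ WindowsMeet hm a e := by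
    by_contra! hcon
    exact hz (trace_mul_eq_zero_of_not_meet hm htr hcon.1 hcon.2.1 hcon.2.2)
  have hcases := windowsMeet_cases (hmeet a b c e hz)
    (hmeet b c e a (by rwa [← hcyc]))
    (hmeet c e a b (by rwa [← hcyc, ← hcyc]))
  have hone (l : Fin N) : ‖t l‖ ≤ 1 :=
    (norm_siteEmbed_le (siteWindow_injective hm l) h).trans hnorm.le
  have hle : ‖t a * (t b * t c * t e)‖ ≤ 1 :=
    calc ‖t a * (t b * t c * t e)‖ ≤ ‖t a‖ * (‖t b‖ * ‖t c‖ * ‖t e‖) := by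
          refine (norm_mul_le _ _).trans ?_
          gcongr
          refine (norm_mul_le _ _).trans ?_
          gcongr
          exact norm_mul_le _ _
      _ ≤ 1 * (1 * 1 * 1) := by gcongr <;> exact hone _
      _ = 1 := by norm_num
  have htrace := norm_trace_le (t a * (t b * t c * t e))
  simp only [Fintype.card_fun, Fintype.card_fin, Nat.cast_pow] at htrace
  refine htrace.trans ?_
  gcongr
  refine hle.trans ?_
  have hnn (P : Prop) [Decidable P] : (0 : ℝ) ≤ if P then 1 else 0 := by positivity
  rcases hcases with h | h | h | h | h | h | h <;> rw [if_pos h] <;>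
    linarith [hnn (WindowsMeet hm a b ∧ WindowsMeet hm c e),
      hnn (WindowsMeet hm a c ∧ WindowsMeet hm b e),
      hnn (WindowsMeet hm a e ∧ WindowsMeet hm b c),
      hnn (WindowsMeet hm a b ∧ WindowsMeet hm a c),
      hnn (WindowsMeet hm b a ∧ WindowsMeet hm b c),
      hnn (WindowsMeet hm c a ∧ WindowsMeet hm c b),
      hnn (WindowsMeet hm e a ∧ WindowsMeet hm e b)]

open Classical in
lemma sum_windowsMeet_le (hm : m ≤ N) (l : Fin N) :
    ∑ l' : Fin N, (if WindowsMeet hm l l' then (1 : ℝ) else 0) ≤ (m : ℝ) ^ 2 := by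
  rw [Finset.sum_boole]
  exact_mod_cast card_windowsMeet_le hm l

open Classical in
lemma sum_windowsMeet_pair_le (hm : m ≤ N) :
    ∑ a : Fin N, ∑ b : Fin N, ∑ c : Fin N, ∑ e : Fin N,
      (if WindowsMeet hm a b ∧ WindowsMeet hm c e then (1 : ℝ) else 0) ≤
        (N : ℝ) ^ 2 * (m : ℝ) ^ 4 := by
  have h1 (a b c e : Fin N) : (if WindowsMeet hm a b ∧ WindowsMeet hm c e then (1 : ℝ) else 0) =
      (if WindowsMeet hm a b then 1 else 0) * (if WindowsMeet hm c e then 1 else 0) := by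
    rw [ite_zero_mul_ite_zero, mul_one]
  have h2 : ∑ a : Fin N, ∑ b : Fin N, (if WindowsMeet hm a b then (1 : ℝ) else 0) ≤
      N * (m : ℝ) ^ 2 :=
    (Finset.sum_le_sum fun a _ => sum_windowsMeet_le hm a).trans (by simp)
  simp only [h1, ← Finset.mul_sum, ← Finset.sum_mul]
  refine (mul_le_mul h2 h2 (by positivity) (by positivity)).trans (le_of_eq (by ring))

open Classical in
lemma sum_windowsMeet_star_le (hm : m ≤ N) :
    ∑ a : Fin N, ∑ b : Fin N, ∑ c : Fin N, ∑ _e : Fin N,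
      (if WindowsMeet hm a b ∧ WindowsMeet hm a c then (1 : ℝ) else 0) ≤
        (N : ℝ) ^ 2 * (m : ℝ) ^ 4 := by
  have h1 (a b c : Fin N) : (if WindowsMeet hm a b ∧ WindowsMeet hm a c then (1 : ℝ) else 0) =
      (if WindowsMeet hm a b then 1 else 0) * (if WindowsMeet hm a c then 1 else 0) := by
    rw [ite_zero_mul_ite_zero, mul_one]
  simp only [h1, Finset.sum_const, Finset.card_univ, Fintype.card_fin, nsmul_eq_mul,
    ← Finset.mul_sum, ← Finset.sum_mul]
  have h2 (a : Fin N) := sum_windowsMeet_le hm a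
  calc (N : ℝ) * ∑ a : Fin N, (∑ b : Fin N, (if WindowsMeet hm a b then (1 : ℝ) else 0)) *
        ∑ c : Fin N, (if WindowsMeet hm a c then (1 : ℝ) else 0)
      ≤ N * ∑ a : Fin N, (m : ℝ) ^ 2 * (m : ℝ) ^ 2 := by
        gcongr <;> exact h2 _
    _ = (N : ℝ) ^ 2 * (m : ℝ) ^ 4 := by simp; ring

lemma sum_rotate_right {M : Type*} [AddCommMonoid M] (F : Fin N → Fin N → Fin N → Fin N → M) :
    ∑ a, ∑ b, ∑ c, ∑ e, F a b c e = ∑ b, ∑ c, ∑ e, ∑ a, F a b c e := by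
  rw [Finset.sum_comm]
  refine Finset.sum_congr rfl fun b _ => ?_
  rw [Finset.sum_comm]
  refine Finset.sum_congr rfl fun c _ => ?_
  rw [Finset.sum_comm]

lemma sum_swap_inner {M : Type*} [AddCommMonoid M] (F : Fin N → Fin N → Fin N → Fin N → M) :
    ∑ a, ∑ b, ∑ c, ∑ e, F a b c e = ∑ a, ∑ c, ∑ b, ∑ e, F a b c e :=
  Finset.sum_congr rfl fun _ _ => Finset.sum_comm

lemma sum_swap_outer {M : Type*} [AddCommMonoid M] (F : Fin N → Fin N → Fin N → Fin N → M) :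
    ∑ a, ∑ b, ∑ c, ∑ e, F a b c e = ∑ b, ∑ a, ∑ c, ∑ e, F a b c e :=
  Finset.sum_comm

lemma norm_trace_Ham_pow_four_le [NeZero dloc] (hm : m ≤ N) {h : Op dloc m} (htr : h.trace = 0)
    (hnorm : opNorm h = 1) :
    ‖(Ham dloc m N h ^ 4).trace‖ ≤ (dloc : ℝ) ^ N * (7 * (m : ℝ) ^ 4 * (N : ℝ) ^ 2) := by
  classical
  have hexp : Ham dloc m N h ^ 4 = ∑ a : Fin N, ∑ b : Fin N, ∑ c : Fin N, ∑ e : Fin N,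
      siteEmbed (siteWindow hm a) h * (siteEmbed (siteWindow hm b) h *
      siteEmbed (siteWindow hm c) h * siteEmbed (siteWindow hm e) h) := by
    rw [Ham_eq_sum hm]
    simp only [← Finset.mul_sum, ← Finset.sum_mul, mul_assoc]
    simp only [pow_succ', pow_zero, mul_one]
  rw [hexp]
  simp only [Matrix.trace_sum]
  refine (norm_sum_le_of_le _ fun a _ => norm_sum_le_of_le _ fun b _ =>
    norm_sum_le_of_le _ fun c _ => norm_sum_le_of_le _ fun e _ =>
      norm_trace_quadruple_le hm htr hnorm a b c e).trans ?_
  simp only [← Finset.mul_sum]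
  gcongr
  simp only [Finset.sum_add_distrib]
  have hp := sum_windowsMeet_pair_le hm
  have hs := sum_windowsMeet_star_le hm
  have h2 : ∑ a : Fin N, ∑ b : Fin N, ∑ c : Fin N, ∑ e : Fin N,
      (if WindowsMeet hm a c ∧ WindowsMeet hm b e then (1 : ℝ) else 0) ≤
        (N : ℝ) ^ 2 * (m : ℝ) ^ 4 := by
    rw [sum_swap_inner]
    exact hp
  have h3 : ∑ a : Fin N, ∑ b : Fin N, ∑ c : Fin N, ∑ e : Fin N,
      (if WindowsMeet hm a e ∧ WindowsMeet hm b c then (1 : ℝ) else 0) ≤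
        (N : ℝ) ^ 2 * (m : ℝ) ^ 4 := by
    rw [sum_rotate_right]
    refine le_trans (le_of_eq ?_) hp
    refine Finset.sum_congr rfl fun b _ => Finset.sum_congr rfl fun c _ => ?_
    rw [Finset.sum_comm]
    simp only [and_comm]
  have h5 : ∑ a : Fin N, ∑ b : Fin N, ∑ c : Fin N, ∑ _e : Fin N,
      (if WindowsMeet hm b a ∧ WindowsMeet hm b c then (1 : ℝ) else 0) ≤
        (N : ℝ) ^ 2 * (m : ℝ) ^ 4 := by
    rw [sum_swap_outer]
    exact hs
  have h6 : ∑ a : Fin N, ∑ b : Fin N, ∑ c : Fin N, ∑ _e : Fin N,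
      (if WindowsMeet hm c a ∧ WindowsMeet hm c b then (1 : ℝ) else 0) ≤
        (N : ℝ) ^ 2 * (m : ℝ) ^ 4 := by
    rw [sum_swap_inner, sum_swap_outer]
    exact hs
  have h7 : ∑ a : Fin N, ∑ b : Fin N, ∑ _c : Fin N, ∑ e : Fin N,
      (if WindowsMeet hm e a ∧ WindowsMeet hm e b then (1 : ℝ) else 0) ≤
        (N : ℝ) ^ 2 * (m : ℝ) ^ 4 := by
    rw [← sum_rotate_right (fun e a b _ => if WindowsMeet hm e a ∧ WindowsMeet hm e b
      then (1 : ℝ) else 0)]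
    exact hs
  linarith

lemma trace_pair_add_right (hm : m ≤ N) (h : Op dloc m) (l l' c : Fin N) :
    (siteEmbed (siteWindow hm (l + c)) h * siteEmbed (siteWindow hm (l' + c)) h).trace =
      (siteEmbed (siteWindow hm l) h * siteEmbed (siteWindow hm l') h).trace := by
  have hw (l : Fin N) : siteWindow hm (l + c) = Equiv.addRight c ∘ siteWindow hm l := by
    funext i
    simp [siteWindow, add_assoc]
  let e : (Fin N → Fin dloc) ≃ (Fin N → Fin dloc) :=
    Equiv.arrowCongr (Equiv.addRight c).symm (Equiv.refl _)
  have he (l : Fin N) : siteEmbed (siteWindow hm (l + c)) h =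
      (siteEmbed (siteWindow hm l) h).submatrix e e := by
    rw [hw, ← siteEmbed_submatrix]
    rfl
  rw [he, he, Matrix.submatrix_mul_equiv]
  exact e.sum_comp fun x =>
    (siteEmbed (siteWindow hm l) h * siteEmbed (siteWindow hm l') h) x x

lemma trace_Ham_sq_eq (hm : m ≤ N) (h : Op dloc m) :
    (Ham dloc m N h ^ 2).trace = N * ∑ l : Fin N,
      (siteEmbed (siteWindow hm l) h * siteEmbed (siteWindow hm 0) h).trace := by
  rw [Ham_eq_sum hm, sq, Finset.mul_sum, Matrix.trace_sum]
  have (l' : Fin N) : ((∑ l, siteEmbed (siteWindow hm l) h) *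
      siteEmbed (siteWindow hm l') h).trace = ∑ l : Fin N,
        (siteEmbed (siteWindow hm l) h * siteEmbed (siteWindow hm 0) h).trace := by
    rw [Finset.sum_mul, Matrix.trace_sum, ← Equiv.sum_comp (Equiv.addRight l')]
    refine Finset.sum_congr rfl fun l _ => ?_
    simpa using trace_pair_add_right hm h l 0 l'
  simp [this]

lemma not_windowsMeet_zero (hm : m ≤ N) {l : Fin N} (h1 : m ≤ l) (h2 : l + m ≤ N) :
    ¬ WindowsMeet hm l 0 := by
  rw [WindowsMeet, not_not, Set.disjoint_left]
  rintro _ ⟨i, rfl⟩ ⟨j, hj⟩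
  have := congrArg Fin.val hj
  simp only [siteWindow, Fin.val_add, Fin.val_castLE, add_zero] at this
  rw [Nat.mod_eq_of_lt (by omega)] at this
  omega

lemma trace_pair_eq_zero [NeZero dloc] (hm : m ≤ N) {h : Op dloc m} (htr : h.trace = 0)
    {l : Fin N} (h1 : m ≤ l) (h2 : l + m ≤ N) :
    (siteEmbed (siteWindow hm l) h * siteEmbed (siteWindow hm 0) h).trace = 0 :=
  trace_siteEmbed_mul_eq_zero (siteWindow_injective hm l)
    (fun x => siteEmbed_commute (not_not.1 (not_windowsMeet_zero hm h1 h2)) x h) htr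

lemma trace_pair_neg (hm : m ≤ N) (h : Op dloc m) (l : Fin N) :
    (siteEmbed (siteWindow hm (-l)) h * siteEmbed (siteWindow hm 0) h).trace =
      (siteEmbed (siteWindow hm l) h * siteEmbed (siteWindow hm 0) h).trace := by
  rw [← trace_pair_add_right hm h (-l) 0 l, neg_add_cancel, zero_add, Matrix.trace_mul_comm]

lemma trace_pair_eq_of_lt (hm : m ≤ N) {L : ℕ} [NeZero L] (hmL : m ≤ L) (hLN : L ≤ N)
    (h : Op dloc m) {n : ℕ} (hn : n + m ≤ L) :
    (dloc : ℂ) ^ L *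
      (siteEmbed (siteWindow hm (Fin.ofNat N n)) h * siteEmbed (siteWindow hm 0) h).trace =
    (siteEmbed (siteWindow hmL (Fin.ofNat L n)) h * siteEmbed (siteWindow hmL 0) h).trace *
      (dloc : ℂ) ^ N := by
  have hw (n : ℕ) (hn : n + m ≤ L) : siteWindow hm (Fin.ofNat N n) =
      Fin.castLE hLN ∘ siteWindow hmL (Fin.ofNat L n) := by
    funext i
    ext
    simp only [siteWindow, Function.comp_apply, Fin.val_add, Fin.val_castLE, Fin.val_ofNat,
      Nat.add_mod_mod]
    rw [Nat.mod_eq_of_lt (by omega), Nat.mod_eq_of_lt (by omega)]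
  have h0 : siteWindow hm 0 = Fin.castLE hLN ∘ siteWindow hmL 0 := hw 0 (by omega)
  have hinj := Fin.castLE_injective hLN
  rw [hw n hn, h0, ← siteEmbed_siteEmbed hinj, ← siteEmbed_siteEmbed hinj, ← siteEmbed_mul hinj]
  simpa using card_mul_trace_siteEmbed hinj
    (siteEmbed (siteWindow hmL (Fin.ofNat L n)) h * siteEmbed (siteWindow hmL 0) h)

end Chain

/-- The variance of the Hamiltonian grows exactly linearly in the system size. -/
lemma exists_trace_Ham_sq_eq {dloc m : ℕ} [NeZero dloc] (hmpos : 1 ≤ m) {h : Op dloc m}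
    (htr : h.trace = 0) :
    ∃ s : ℂ, ∀ N, 2 * m ≤ N → (Ham dloc m N h ^ 2).trace = (dloc : ℂ) ^ N * (N * s) := by
  have : NeZero (2 * m) := ⟨by omega⟩
  have hmL : m ≤ 2 * m := by omega
  let g : ℕ → ℂ := fun n => (siteEmbed (siteWindow hmL (Fin.ofNat (2 * m) n)) h *
    siteEmbed (siteWindow hmL 0) h).trace / (dloc : ℂ) ^ (2 * m)
  have hd : (dloc : ℂ) ≠ 0 := Nat.cast_ne_zero.2 (NeZero.ne dloc)
  refine ⟨∑ n ∈ Finset.range m, g n + ∑ n ∈ Finset.Ico 1 m, g n, fun N hN => ?_⟩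
  have : NeZero N := ⟨by omega⟩
  have hm : m ≤ N := by omega
  let G : ℕ → ℂ := fun n =>
    (siteEmbed (siteWindow hm (Fin.ofNat N n)) h * siteEmbed (siteWindow hm 0) h).trace
  have hG (n : ℕ) (hn : n < m) : G n = (dloc : ℂ) ^ N * g n := by
    have := trace_pair_eq_of_lt hm hmL hN h (n := n) (by omega)
    simp only [G, g]
    field_simp
    linear_combination this
  have hsum : ∑ l : Fin N, (siteEmbed (siteWindow hm l) h *
      siteEmbed (siteWindow hm 0) h).trace = ∑ n ∈ Finset.range N, G n := by
    rw [← Fin.sum_univ_eq_sum_range]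
    refine Finset.sum_congr rfl fun l _ => ?_
    simp only [G, Fin.ofNat_val_eq_self]
  have hmid : ∑ n ∈ Finset.Ico m (N + 1 - m), G n = 0 := by
    refine Finset.sum_eq_zero fun n hn => ?_
    rw [Finset.mem_Ico] at hn
    have hval : ((Fin.ofNat N n : Fin N) : ℕ) = n := by
      rw [Fin.val_ofNat, Nat.mod_eq_of_lt (by omega)]
    exact trace_pair_eq_zero hm htr (by omega) (by omega)
  have htop : ∑ n ∈ Finset.Ico (N + 1 - m) N, G n = ∑ n ∈ Finset.Ico 1 m, G n := by
    have := Finset.sum_Ico_reflect G 1 (show m ≤ N + 1 by omega)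
    rw [show N + 1 - 1 = N by omega] at this
    rw [← this]
    refine Finset.sum_congr rfl fun n hn => ?_
    rw [Finset.mem_Ico] at hn
    simp only [G]
    rw [← trace_pair_neg hm h (Fin.ofNat N n)]
    congr 4
    ext
    simp only [Fin.val_neg', Fin.val_ofNat]
    rw [Nat.mod_eq_of_lt (show n < N by omega)]
  rw [trace_Ham_sq_eq hm, hsum, Finset.range_eq_Ico,
    ← Finset.sum_Ico_consecutive G (Nat.zero_le m) hm,
    ← Finset.sum_Ico_consecutive G (show m ≤ N + 1 - m by omega) (by omega), hmid, htop,
    zero_add, mul_left_comm ((dloc : ℂ) ^ N), mul_add ((dloc : ℂ) ^ N),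
    Finset.mul_sum _ _ ((dloc : ℂ) ^ N), Finset.mul_sum _ _ ((dloc : ℂ) ^ N),
    Finset.range_eq_Ico]
  congr 2 <;> exact Finset.sum_congr rfl fun n hn => hG n (Finset.mem_Ico.1 hn).2

section Eigenbasis

variable {dloc N : ℕ} {H : Op dloc N} (D : EigData dloc N H)

lemma sum_eev_eq_trace (B : Op dloc N) : ∑ j, eev D B j = B.trace := by
  let U : Op dloc N := Matrix.of fun x j => D.v j x
  have h1 : Uᴴ * U = 1 := by
    ext j j'
    rw [Matrix.one_apply, ← D.orth j j']
    rfl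
  have h2 : U * Uᴴ = 1 := mul_eq_one_comm.1 h1
  have h3 : ∑ j, eev D B j = (Uᴴ * (B * U)).trace := rfl
  rw [h3, Matrix.trace_mul_comm, mul_assoc, h2, mul_one]

lemma eev_pow (n : ℕ) (j : Fin N → Fin dloc) : eev D (H ^ n) j = (D.E j : ℂ) ^ n := by
  have h1 : (H ^ n).mulVec (D.v j) = (D.E j : ℂ) ^ n • D.v j := by
    induction n with
    | zero => simp
    | succ n ih => rw [pow_succ, ← Matrix.mulVec_mulVec, D.eigH, Matrix.mulVec_smul, ih,
        smul_smul, pow_succ']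
  rw [eev, h1, dotProduct_smul, D.orth]
  simp

lemma sum_energy_pow (n : ℕ) : ((∑ j, D.E j ^ n : ℝ) : ℂ) = (H ^ n).trace := by
  rw [← sum_eev_eq_trace D]
  simp [eev_pow]

lemma abs_energy_le (j : Fin N → Fin dloc) : |D.E j| ≤ opNorm H := by
  open scoped Matrix.Norms.L2Operator in
  have hv : WithLp.toLp 2 (D.v j) ≠ 0 := by
    intro h0
    have h1 : D.v j = 0 := by simpa using h0
    have := D.orth j j
    simp [h1] at this
  have h1 := Matrix.l2_opNorm_mulVec H (WithLp.toLp 2 (D.v j))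
  rw [D.eigH, map_smul, norm_smul, Complex.norm_real, Real.norm_eq_abs] at h1
  exact le_of_mul_le_mul_right h1 (norm_pos_iff.2 hv)

end Eigenbasis

lemma abs_pow_three_le {t : ℝ} (ht : 0 < t) (x : ℝ) : |x| ^ 3 ≤ (t * x ^ 2 + x ^ 4 / t) / 2 := by
  have h1 : (t * x ^ 2 + x ^ 4 / t) / 2 - |x| ^ 3 = |x| ^ 2 * (t - |x|) ^ 2 / (2 * t) := by
    rw [← sq_abs x, ← Even.pow_abs (by decide : Even 4) x]
    field_simp
    ring
  have h2 : 0 ≤ |x| ^ 2 * (t - |x|) ^ 2 / (2 * t) := by positivity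
  linarith

lemma sum_norm_div_card_le_sqrt {J : Type*} [Fintype J] [Nonempty J] (P : J → ℂ) :
    (∑ j, ‖P j‖) / Fintype.card J ≤ √(1 / Fintype.card J * ∑ j, ‖P j‖ ^ 2) := by
  have hd : (0 : ℝ) < Fintype.card J := Nat.cast_pos.2 Fintype.card_pos
  apply Real.le_sqrt_of_sq_le
  have := sq_sum_le_card_mul_sum_sq (s := Finset.univ) (f := fun j => ‖P j‖)
  rw [div_pow, div_le_iff₀ (by positivity)]
  rw [Finset.card_univ] at this
  refine this.trans (le_of_eq ?_)
  field_simp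

/-- The average of the second-order Taylor expansion of `f` over the spectrum is controlled by
`r_f` and by the fourth moment of the energy. -/
lemma norm_taylor_average_le {dloc k k' N : ℕ} [NeZero dloc] [NeZero N] (hk : k ≤ N)
    (hk' : k' ≤ N) {h : Op dloc k} (htr : h.trace = 0) (hnorm : opNorm h = 1)
    (D : EigData dloc N (Ham dloc k N h)) {A : Op dloc k'} (hAtr : A.trace = 0)
    {f : ℝ → ℂ} {c0 c1 c2 : ℂ} {M : ℝ} (hf : SmoothFn f c0 c1 c2 M) {s : ℂ}
    (hs : (Ham dloc k N h ^ 2).trace = (dloc : ℂ) ^ N * (N * s)) :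
    ‖N * c0 + c2 * s / 2‖ ≤ N * rf D (embed dloc k' N A) f +
      M * (‖s‖ + 7 * (k : ℝ) ^ 4) / 2 / √N := by
  obtain ⟨hM, -, hT⟩ := hf
  have hN : (0 : ℝ) < N := Nat.cast_pos.2 (NeZero.pos N)
  have hNC : (N : ℂ) ≠ 0 := Nat.cast_ne_zero.2 (NeZero.ne N)
  have hd : (0 : ℝ) < (dloc : ℝ) ^ N := pow_pos (Nat.cast_pos.2 (NeZero.pos dloc)) N
  have hcard : (Fintype.card (Fin N → Fin dloc) : ℝ) = (dloc : ℝ) ^ N := by simp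
  have hx (j) : D.E j / N ∈ Set.Icc (-1 : ℝ) 1 := by
    rw [Set.mem_Icc, ← abs_le, abs_div, Nat.abs_cast, div_le_one hN]
    refine (abs_energy_le D j).trans ((norm_Ham_le hk h).trans_eq ?_)
    change N * opNorm h = N
    rw [hnorm, mul_one]
  have hE1 : ∑ j, (D.E j : ℂ) = 0 := by
    have := sum_energy_pow D 1
    simpa [trace_Ham hk htr] using this
  have hE2 : ∑ j, (D.E j : ℂ) ^ 2 = (dloc : ℂ) ^ N * (N * s) := by
    rw [← hs, ← sum_energy_pow D 2]
    push_cast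
    rfl
  have hE2' : ∑ j, D.E j ^ 2 ≤ (dloc : ℝ) ^ N * (N * ‖s‖) := by
    refine (le_abs_self _).trans (le_of_eq ?_)
    rw [← Real.norm_eq_abs, ← Complex.norm_real, sum_energy_pow D 2, hs]
    simp
  have hE4 : ∑ j, D.E j ^ 4 ≤ (dloc : ℝ) ^ N * (7 * (k : ℝ) ^ 4 * (N : ℝ) ^ 2) := by
    refine (le_abs_self _).trans ?_
    rw [← Real.norm_eq_abs, ← Complex.norm_real, sum_energy_pow D 4]
    exact norm_trace_Ham_pow_four_le hk htr hnorm
  have hA : ∑ j, eev D (embed dloc k' N A) j = 0 := by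
    rw [sum_eev_eq_trace, embed_eq_siteEmbed hk']
    simpa using trace_siteEmbed_mul_eq_zero (Fin.castLE_injective hk')
      (fun b => Commute.one_right _) hAtr
  set P : (Fin N → Fin dloc) → ℂ := fun j => eev D (embed dloc k' N A) j - f (D.E j / N) with hP
  set R : (Fin N → Fin dloc) → ℂ := fun j => f (D.E j / N) - c0 - c1 * ((D.E j / N : ℝ) : ℂ) -
    c2 / 2 * ((D.E j / N : ℝ) : ℂ) ^ 2 with hR
  have hsum : ∑ j, P j + ∑ j, R j = -((dloc : ℂ) ^ N / N * (N * c0 + c2 * s / 2)) := by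
    have hPR (j) : P j + R j = eev D (embed dloc k' N A) j - c0 - c1 / N * D.E j -
        c2 / (2 * N ^ 2) * (D.E j : ℂ) ^ 2 := by
      simp only [hP, hR]
      push_cast
      field_simp
      ring
    rw [← Finset.sum_add_distrib]
    simp only [hPR, Finset.sum_sub_distrib, ← Finset.mul_sum, hA, hE1, hE2]
    simp only [Finset.sum_const, Finset.card_univ, Fintype.card_fun, Fintype.card_fin,
      nsmul_eq_mul, Nat.cast_pow]
    field_simp
    ring
  have hPle : (∑ j, ‖P j‖) / (dloc : ℝ) ^ N ≤ rf D (embed dloc k' N A) f := by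
    have := sum_norm_div_card_le_sqrt P
    rwa [hcard] at this
  have hsq : √(N : ℝ) ^ 2 = N := Real.sq_sqrt hN.le
  have hsqrt : 0 < √(N : ℝ) := Real.sqrt_pos.2 hN
  have hRle : ∑ j, ‖R j‖ ≤
      (dloc : ℝ) ^ N / N * (M * (‖s‖ + 7 * (k : ℝ) ^ 4) / 2 / √N) := by
    calc ∑ j, ‖R j‖ ≤ ∑ j, M * |D.E j / N| ^ 3 := Finset.sum_le_sum fun j _ => hT _ (hx j)
      _ = M / (N : ℝ) ^ 3 * ∑ j, |D.E j| ^ 3 := by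
          rw [Finset.mul_sum]
          refine Finset.sum_congr rfl fun j _ => ?_
          rw [abs_div, Nat.abs_cast]
          ring
      _ ≤ M / (N : ℝ) ^ 3 * ∑ j, (√N * D.E j ^ 2 + D.E j ^ 4 / √N) / 2 := by
          gcongr with j
          exact abs_pow_three_le hsqrt _
      _ = M / (N : ℝ) ^ 3 * ((√N * ∑ j, D.E j ^ 2 + (∑ j, D.E j ^ 4) / √N) / 2) := by
          rw [← Finset.sum_div, Finset.sum_add_distrib, Finset.mul_sum, Finset.sum_div]
      _ ≤ M / (N : ℝ) ^ 3 * ((√N * ((dloc : ℝ) ^ N * (N * ‖s‖)) +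
            ((dloc : ℝ) ^ N * (7 * (k : ℝ) ^ 4 * (N : ℝ) ^ 2)) / √N) / 2) := by
          gcongr
      _ = (dloc : ℝ) ^ N / N * (M * (‖s‖ + 7 * (k : ℝ) ^ 4) / 2 / √N) := by
          field_simp
          rw [hsq]
          ring
  have hfin : (dloc : ℝ) ^ N / N * ‖N * c0 + c2 * s / 2‖ ≤ (dloc : ℝ) ^ N / N *
      (N * rf D (embed dloc k' N A) f + M * (‖s‖ + 7 * (k : ℝ) ^ 4) / 2 / √N) := by
    calc (dloc : ℝ) ^ N / N * ‖N * c0 + c2 * s / 2‖ = ‖∑ j, P j + ∑ j, R j‖ := by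
          rw [hsum, norm_neg, norm_mul, norm_div, norm_pow, Complex.norm_natCast,
            Complex.norm_natCast]
      _ ≤ ∑ j, ‖P j‖ + ∑ j, ‖R j‖ :=
          (norm_add_le _ _).trans (add_le_add (norm_sum_le _ _) (norm_sum_le _ _))
      _ ≤ rf D (embed dloc k' N A) f * (dloc : ℝ) ^ N +
          (dloc : ℝ) ^ N / N * (M * (‖s‖ + 7 * (k : ℝ) ^ 4) / 2 / √N) :=
          add_le_add ((div_le_iff₀ hd).1 hPle) hRle
      _ = _ := by
          field_simp
  exact le_of_mul_le_mul_left hfin (by positivity)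

lemma isHermitian_Ham {dloc k N : ℕ} {h : Op dloc k} [NeZero N] (hk : k ≤ N)
    (hherm : h.IsHermitian) : (Ham dloc k N h).IsHermitian := by
  rw [Ham_eq_sum hk, Matrix.IsHermitian, Matrix.conjTranspose_sum]
  refine Finset.sum_congr rfl fun l _ => ?_
  have := map_star (siteEmbedHom (α := Fin dloc) _ (siteWindow_injective hk l)) h
  rw [Matrix.star_eq_conjTranspose, hherm.eq] at this
  exact this.symm

/-- If `A` is traceless with `‖A‖ = 1`, `f` is smooth, the Hamiltonian is
nonzero for arbitrarily large system sizes, and `N_i r_f(N_i) → 0` along a strictly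
increasing sequence `N_i`, then `f''(0) = 0`. -/
theorem taylor_second_deriv_eq_zero (dloc k k' : ℕ) (hdloc : 2 ≤ dloc) (hk : 1 ≤ k)
    (h : Op dloc k) (hherm : h.IsHermitian) (htr : h.trace = 0) (hnorm : opNorm h = 1)
    (D : ∀ N, EigData dloc N (Ham dloc k N h))
    (hH : ∀ N₀ : ℕ, ∃ N : ℕ, N₀ ≤ N ∧ Ham dloc k N h ≠ 0)
    (A : Op dloc k') (hAtr : A.trace = 0) (hAnorm : opNorm A = 1)
    (f : ℝ → ℂ) (c0 c1 c2 : ℂ) (M : ℝ) (hf : SmoothFn f c0 c1 c2 M)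
    (Ni : ℕ → ℕ) (hmono : StrictMono Ni)
    (hlim : Filter.Tendsto
      (fun i => (Ni i : ℝ) * rf (D (Ni i)) (embed dloc k' (Ni i) A) f)
      Filter.atTop (nhds 0)) :
    c2 = 0 := by
  have : NeZero dloc := ⟨by omega⟩
  obtain ⟨s, hs⟩ := exists_trace_Ham_sq_eq hk htr
  have hs0 : s ≠ 0 := by
    rintro rfl
    obtain ⟨N, hN, hne⟩ := hH (2 * k)
    have : NeZero N := ⟨by omega⟩
    have hz := hs N hN
    rw [mul_zero, mul_zero, sq] at hz
    nth_rewrite 1 [← (isHermitian_Ham (by omega) hherm).eq] at hz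
    open scoped ComplexOrder in
    exact hne (Matrix.trace_conjTranspose_mul_self_eq_zero_iff.1 hz)
  have hNi : Tendsto (fun i => (Ni i : ℝ)) atTop atTop :=
    tendsto_natCast_atTop_atTop.comp hmono.tendsto_atTop
  have hconv : Tendsto (fun i => (Ni i : ℂ) * c0 + c2 * s / 2) atTop (nhds 0) := by
    have hbound : Tendsto (fun i => (Ni i : ℝ) * rf (D (Ni i)) (embed dloc k' (Ni i) A) f +
        M * (‖s‖ + 7 * (k : ℝ) ^ 4) / 2 / √(Ni i : ℝ)) atTop (nhds 0) := by
      simpa using hlim.add ((Real.tendsto_sqrt_atTop.comp hNi).const_div_atTop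
        (M * (‖s‖ + 7 * (k : ℝ) ^ 4) / 2))
    refine squeeze_zero_norm' ?_ hbound
    filter_upwards [hmono.tendsto_atTop.eventually_ge_atTop (2 * k + k')] with i hi
    have : NeZero (Ni i) := ⟨by omega⟩
    exact norm_taylor_average_le (by omega) (by omega) htr hnorm (D (Ni i)) hAtr hf
      (hs (Ni i) (by omega))
  have hinv : Tendsto (fun i => ((Ni i : ℂ))⁻¹) atTop (nhds 0) :=
    tendsto_inv_atTop_nhds_zero_nat.comp hmono.tendsto_atTop
  have hc0 : c0 = 0 := by
    have h1 : Tendsto (fun i => ((Ni i : ℂ))⁻¹ * ((Ni i : ℂ) * c0 + c2 * s / 2) -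
        ((Ni i : ℂ))⁻¹ * (c2 * s / 2)) atTop (nhds 0) := by
      simpa using (hinv.mul hconv).sub (hinv.mul_const (c2 * s / 2))
    refine tendsto_nhds_unique (tendsto_const_nhds.congr' ?_) h1
    filter_upwards [hmono.tendsto_atTop.eventually_ge_atTop 1] with i hi
    have : (Ni i : ℂ) ≠ 0 := Nat.cast_ne_zero.2 (by omega)
    field_simp
    ring
  have h2 : c2 * s / 2 = 0 := by
    simp only [hc0, mul_zero, zero_add] at hconv
    exact tendsto_nhds_unique tendsto_const_nhds hconv
  simpa [hs0] using h2
end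

section
/- Suppose h is nonzero, canonical, and exactly k-local. Then there exists a traceless operator A on the first 3k − 1 sites (which may be taken to be a single generalized Pauli string) such that for all sufficiently large N, tr(H_N A) = 0 and tr(H_N² A) ≠ 0; in particular, (tr(H_N h)/d)·(tr(H_N² A)/d) ≠ (tr(H_N² h)/d)·(tr(H_N A)/d). -/
open Matrix MeasureTheory Filter

open scoped Kronecker

/-- The operator `a` acting on the sites `f i` of a larger system, tensored with the identity
on the sites outside the range of `f`. -/
noncomputable def place {ι κ : Type*} {d : ℕ} (f : ι → κ)
    (a : Matrix (ι → Fin d) (ι → Fin d) ℂ) : Matrix (κ → Fin d) (κ → Fin d) ℂ :=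
  open Classical in
  fun x y => a (x ∘ f) (y ∘ f) * if ∀ i, i ∉ Set.range f → x i = y i then 1 else 0

section Place

variable {ι ι' κ : Type*} {d : ℕ}

/-- Configurations split into the part on the range of `f` and the part outside it. -/
noncomputable def splitRange (d : ℕ) (f : ι → κ) (hf : f.Injective) :
    (κ → Fin d) ≃ (ι → Fin d) × ({i // i ∉ Set.range f} → Fin d) :=
  open Classical in
  (Equiv.piEquivPiSubtypeProd (fun i => i ∈ Set.range f) (fun _ => Fin d)).trans
    (Equiv.prodCongr (Equiv.arrowCongr (Equiv.ofInjective f hf).symm (Equiv.refl _))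
      (Equiv.refl _))

lemma splitRange_apply (f : ι → κ) (hf : f.Injective) (x : κ → Fin d) :
    splitRange d f hf x = (x ∘ f, fun i : {i // i ∉ Set.range f} => x i) := by
  ext <;> rfl

lemma place_eq_submatrix [DecidableEq κ] (f : ι → κ) (hf : f.Injective)
    (a : Matrix (ι → Fin d) (ι → Fin d) ℂ) [DecidableEq ({i // i ∉ Set.range f} → Fin d)] :
    place f a = (a ⊗ₖ (1 : Matrix ({i // i ∉ Set.range f} → Fin d) _ ℂ)).submatrix
      (splitRange d f hf) (splitRange d f hf) := by
  classical
  ext x y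
  simp only [place, submatrix_apply, splitRange_apply, kroneckerMap_apply, one_apply]
  congr 1
  refine if_congr ?_ rfl rfl
  simp only [funext_iff, Subtype.forall]

lemma place_mul [Fintype ι] [Fintype κ] [DecidableEq ι] [DecidableEq κ] (f : ι → κ)
    (hf : f.Injective) (a b : Matrix (ι → Fin d) (ι → Fin d) ℂ) :
    place f a * place f b = place f (a * b) := by
  classical
  rw [place_eq_submatrix f hf, place_eq_submatrix f hf, place_eq_submatrix f hf,
    submatrix_mul_equiv, ← mul_kronecker_mul, Matrix.mul_one]

lemma trace_place_ne_zero [Fintype ι] [Fintype κ] [DecidableEq ι] [DecidableEq κ] (hd : 2 ≤ d)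
    (f : ι → κ) (hf : f.Injective)
    {a : Matrix (ι → Fin d) (ι → Fin d) ℂ} (ha : a.trace ≠ 0) : (place f a).trace ≠ 0 := by
  classical
  rw [place_eq_submatrix f hf]
  have : (((a ⊗ₖ (1 : Matrix ({i // i ∉ Set.range f} → Fin d) _ ℂ)).submatrix
      (splitRange d f hf) (splitRange d f hf))).trace =
      (a ⊗ₖ (1 : Matrix ({i // i ∉ Set.range f} → Fin d) _ ℂ)).trace :=
    Equiv.sum_comp (splitRange d f hf)
      (fun i => (a ⊗ₖ (1 : Matrix ({i // i ∉ Set.range f} → Fin d) _ ℂ)) i i)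
  rw [this, trace_kronecker, trace_one]
  refine mul_ne_zero ha ?_
  have : NeZero d := ⟨by omega⟩
  exact_mod_cast Fintype.card_ne_zero

/-- The tensor product of operators on two disjoint sets of sites. -/
def tensorOp (a : Matrix (ι → Fin d) (ι → Fin d) ℂ) (b : Matrix (ι' → Fin d) (ι' → Fin d) ℂ) :
    Matrix (ι ⊕ ι' → Fin d) (ι ⊕ ι' → Fin d) ℂ :=
  (a ⊗ₖ b).submatrix (Equiv.sumArrowEquivProdArrow ι ι' (Fin d))
    (Equiv.sumArrowEquivProdArrow ι ι' (Fin d))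

lemma tensorOp_apply (a : Matrix (ι → Fin d) (ι → Fin d) ℂ)
    (b : Matrix (ι' → Fin d) (ι' → Fin d) ℂ) (x y : ι ⊕ ι' → Fin d) :
    tensorOp a b x y = a (x ∘ Sum.inl) (y ∘ Sum.inl) * b (x ∘ Sum.inr) (y ∘ Sum.inr) :=
  rfl

lemma tensorOp_mul [Fintype ι] [Fintype ι'] [DecidableEq ι] [DecidableEq ι']
    (a a' : Matrix (ι → Fin d) (ι → Fin d) ℂ)
    (b b' : Matrix (ι' → Fin d) (ι' → Fin d) ℂ) :
    tensorOp a b * tensorOp a' b' = tensorOp (a * a') (b * b') := by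
  simp only [tensorOp, submatrix_mul_equiv, mul_kronecker_mul]

lemma trace_tensorOp [Fintype ι] [Fintype ι'] [DecidableEq ι] [DecidableEq ι']
    (a : Matrix (ι → Fin d) (ι → Fin d) ℂ)
    (b : Matrix (ι' → Fin d) (ι' → Fin d) ℂ) :
    (tensorOp a b).trace = a.trace * b.trace := by
  rw [← trace_kronecker]
  exact Equiv.sum_comp (Equiv.sumArrowEquivProdArrow ι ι' (Fin d)) (fun i => (a ⊗ₖ b) i i)

lemma place_eq_place_tensorOp_one [Fintype ι] [Fintype ι'] (f : ι → κ) (g : ι' → κ)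
    (hfg : (Sum.elim f g).Injective)
    (a : Matrix (ι → Fin d) (ι → Fin d) ℂ) :
    place f a = place (Sum.elim f g) (tensorOp a 1) := by
  classical
  ext x y
  simp only [place, tensorOp_apply, one_apply,
    ← ite_and, mul_ite, mul_one, mul_zero]
  have hd : ∀ i j, f i ≠ g j := fun i j h => by
    have := @hfg (Sum.inl i) (Sum.inr j) h
    simp at this
  refine if_congr ?_ rfl rfl
  simp only [funext_iff, Function.comp_apply,
    Sum.elim_inr, Set.mem_range, Sum.exists, Sum.elim_inl, not_or, not_exists]
  constructor
  · exact fun h => ⟨fun i hi => h i hi.1, fun j => h _ fun i => hd i j⟩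
  · rintro ⟨h1, h2⟩ i hi
    by_cases hg : ∃ j, g j = i
    · obtain ⟨j, rfl⟩ := hg
      exact h2 j
    · exact h1 i ⟨hi, fun j hj => hg ⟨j, hj⟩⟩

lemma place_eq_place_one_tensorOp [Fintype ι] [Fintype ι'] (f : ι → κ) (g : ι' → κ)
    (hfg : (Sum.elim f g).Injective)
    (b : Matrix (ι' → Fin d) (ι' → Fin d) ℂ) :
    place g b = place (Sum.elim f g) (tensorOp 1 b) := by
  classical
  ext x y
  simp only [place, tensorOp_apply, one_apply,
    ← ite_and, mul_ite, mul_one, mul_zero, ite_mul, one_mul, zero_mul]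
  have hd : ∀ i j, f i ≠ g j := fun i j h => by
    have := @hfg (Sum.inl i) (Sum.inr j) h
    simp at this
  refine if_congr ?_ rfl rfl
  simp only [funext_iff, Function.comp_apply,
    Sum.elim_inr, Set.mem_range, Sum.exists, Sum.elim_inl, not_or, not_exists]
  constructor
  · exact fun h => ⟨fun i hi => h i hi.2, fun i => h _ fun j => (hd i j).symm⟩
  · rintro ⟨h1, h2⟩ i hi
    by_cases hg : ∃ j, f j = i
    · obtain ⟨j, rfl⟩ := hg
      exact h2 j
    · exact h1 i ⟨fun j hj => hg ⟨j, hj⟩, hi⟩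

end Place

section PartialTrace

variable {ι κ : Type*} [DecidableEq κ] {d : ℕ}

/-- Cyclic relabelling of the local states at site `s`. -/
def siteShift [NeZero d] (s : κ) (c : Fin d) : Equiv.Perm (κ → Fin d) :=
  Equiv.piCongrRight fun i => if i = s then Equiv.addRight c else Equiv.refl _

lemma siteShift_apply [NeZero d] (s : κ) (c : Fin d) (x : κ → Fin d) :
    siteShift s c x = Function.update x s (x s + c) := by
  ext i
  by_cases h : i = s
  · subst h; simp [siteShift]
  · simp [siteShift, h]

/-- `B` is diagonal at site `s` and invariant under cyclic relabelling there; this holds for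
operators acting as the identity at `s`. -/
def ActsTriviallyAt [NeZero d] (s : κ) (B : Matrix (κ → Fin d) (κ → Fin d) ℂ) : Prop :=
  (∀ x y, x s ≠ y s → B x y = 0) ∧ ∀ c, B.submatrix (siteShift s c) (siteShift s c) = B

/-- The partial trace of `C` over site `s` vanishes. -/
def PartialTraceZero (s : κ) (C : Matrix (κ → Fin d) (κ → Fin d) ℂ) : Prop :=
  ∀ x y, ∑ c, C (Function.update x s c) (Function.update y s c) = 0

lemma actsTriviallyAt_one [NeZero d] (s : κ) [DecidableEq (κ → Fin d)] :
    ActsTriviallyAt s (1 : Matrix (κ → Fin d) (κ → Fin d) ℂ) := by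
  refine ⟨fun x y h => one_apply_ne fun e => h (e ▸ rfl), fun c => submatrix_one_equiv _⟩

lemma ActsTriviallyAt.mul [Fintype κ] [NeZero d] {s : κ} {B C : Matrix (κ → Fin d) (κ → Fin d) ℂ}
    (hB : ActsTriviallyAt s B) (hC : ActsTriviallyAt s C) : ActsTriviallyAt s (B * C) := by
  refine ⟨fun x y h => ?_, fun c => ?_⟩
  · rw [mul_apply]
    refine Finset.sum_eq_zero fun z _ => ?_
    by_cases hz : x s = z s
    · rw [hC.1 z y (hz ▸ h), mul_zero]
    · rw [hB.1 x z hz, zero_mul]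
  · rw [← submatrix_mul_equiv B C _ (siteShift s c), hB.2 c, hC.2 c]

lemma trace_mul_eq_zero [Fintype κ] [NeZero d] {s : κ} {B C : Matrix (κ → Fin d) (κ → Fin d) ℂ}
    (hB : ActsTriviallyAt s B) (hC : PartialTraceZero s C) : (B * C).trace = 0 := by
  have key : ∀ c, (B * C).trace = ∑ x, ∑ y, B x y * C (siteShift s c y) (siteShift s c x) := by
    intro c
    rw [trace, ← Equiv.sum_comp (siteShift s c)]
    refine Finset.sum_congr rfl fun x _ => ?_
    rw [diag_apply, mul_apply, ← Equiv.sum_comp (siteShift s c)]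
    refine Finset.sum_congr rfl fun y _ => ?_
    rw [← congrFun (congrFun (hB.2 c) x) y, submatrix_apply]
  have hsum : ∑ _c : Fin d, (B * C).trace = 0 := by
    rw [Finset.sum_congr rfl fun c _ => key c, Finset.sum_comm]
    refine Finset.sum_eq_zero fun x _ => ?_
    rw [Finset.sum_comm]
    refine Finset.sum_eq_zero fun y _ => ?_
    rw [← Finset.mul_sum]
    by_cases h : x s = y s
    · simp only [siteShift_apply, h]
      have := Equiv.sum_comp (Equiv.addLeft (y s))
        (fun c => C (Function.update y s c) (Function.update x s c))
      simp only [Equiv.coe_addLeft] at this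
      rw [this, hC, mul_zero]
    · rw [hB.1 x y h, zero_mul]
  rw [Finset.sum_const, nsmul_eq_mul, mul_eq_zero] at hsum
  refine hsum.resolve_left ?_
  simpa using NeZero.ne d

lemma actsTriviallyAt_place [NeZero d] {f : ι → κ} {s : κ} (hs : s ∉ Set.range f)
    (a : Matrix (ι → Fin d) (ι → Fin d) ℂ) : ActsTriviallyAt s (place f a) := by
  classical
  refine ⟨fun x y h => ?_, fun c => ?_⟩
  · rw [place, if_neg fun h' => h (h' s hs), mul_zero]
  · have hcomp : ∀ x : κ → Fin d, siteShift s c x ∘ f = x ∘ f := by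
      intro x
      rw [siteShift_apply]
      ext i
      rw [Function.comp_apply, Function.update_of_ne fun h => hs ⟨i, h⟩, Function.comp_apply]
    ext x y
    simp only [submatrix_apply, place, hcomp]
    congr 1
    refine if_congr (forall₂_congr fun i _ => ?_) rfl rfl
    simp only [siteShift_apply]
    by_cases h : i = s
    · subst h; simp
    · simp [h]

lemma partialTraceZero_place [DecidableEq ι] {f : ι → κ} (hf : f.Injective) {s : ι}
    {a : Matrix (ι → Fin d) (ι → Fin d) ℂ} (ha : PartialTraceZero s a) :
    PartialTraceZero (f s) (place f a) := by
  classical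
  intro x y
  simp only [place, Function.update_comp_eq_of_injective _ hf]
  rw [Finset.sum_congr rfl (g := fun c => a (Function.update (x ∘ f) s c)
    (Function.update (y ∘ f) s c) * if ∀ i, i ∉ Set.range f → x i = y i then 1 else 0),
    ← Finset.sum_mul, ha, zero_mul]
  intro c _
  congr 1
  refine if_congr (forall₂_congr fun i hi => ?_) rfl rfl
  have : i ≠ f s := fun h => hi ⟨s, h.symm⟩
  simp [this]

end PartialTrace

section Pauli

variable {ι κ : Type*} [Fintype ι] [Fintype κ] {d : ℕ}

/-- The single-site operator `X^a Z^b`. -/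
noncomputable def sitePauli (d : ℕ) (a b x y : Fin d) : ℂ :=
  if (x : ℕ) = ((y : ℕ) + (a : ℕ)) % d then
    Complex.exp (2 * Real.pi * Complex.I * (b : ℕ) * (y : ℕ) / d)
  else 0

/-- The generalized Pauli string on an arbitrary finite set of sites. -/
noncomputable def pauliOn (a b : ι → Fin d) : Matrix (ι → Fin d) (ι → Fin d) ℂ :=
  fun x y => ∏ i, sitePauli d (a i) (b i) (x i) (y i)

lemma pauli_eq_pauliOn (m : ℕ) (a b : Fin m → Fin d) : pauli d m a b = pauliOn a b := by
  ext x y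
  simp only [pauli, pauliOn, sitePauli]
  by_cases h : ∀ i, (x i : ℕ) = ((y i : ℕ) + (a i : ℕ)) % d
  · rw [if_pos h]
    exact Finset.prod_congr rfl fun i _ => (if_pos (h i)).symm
  · rw [if_neg h]
    push Not at h
    obtain ⟨i, hi⟩ := h
    exact (Finset.prod_eq_zero (Finset.mem_univ i) (if_neg hi)).symm

lemma sitePauli_zero [NeZero d] (x y : Fin d) :
    sitePauli d 0 0 x y = if x = y then 1 else 0 := by
  simp [sitePauli, Nat.mod_eq_of_lt, Fin.ext_iff]

lemma exp_eq_pow (m n : ℕ) :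
    Complex.exp (2 * Real.pi * Complex.I * m * n / d) =
      (Complex.exp (2 * Real.pi * Complex.I / d) ^ m) ^ n := by
  rw [← Complex.exp_nat_mul, ← Complex.exp_nat_mul]
  congr 1
  ring

lemma sum_pow_eq_zero {w : ℂ} (hw : w ^ d = 1) (hne : w ≠ 1) :
    ∑ c : Fin d, w ^ (c : ℕ) = 0 := by
  rw [Fin.sum_univ_eq_sum_range (fun i => w ^ i)]
  have h := mul_geom_sum w d
  rw [hw, sub_self, mul_eq_zero] at h
  exact h.resolve_left (sub_ne_zero.2 hne)

lemma sum_sitePauli_diag [NeZero d] {a b : Fin d} (hab : (a : ℕ) ≠ 0 ∨ (b : ℕ) ≠ 0) :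
    ∑ c, sitePauli d a b c c = 0 := by
  by_cases ha : (a : ℕ) = 0
  · have hb := hab.resolve_left fun h => h ha
    have hζ := Complex.isPrimitiveRoot_exp d (NeZero.ne d)
    rw [← sum_pow_eq_zero (d := d)
      (w := Complex.exp (2 * Real.pi * Complex.I / d) ^ (b : ℕ))]
    · refine Finset.sum_congr rfl fun c _ => ?_
      rw [sitePauli, if_pos, exp_eq_pow]
      rw [ha, add_zero, Nat.mod_eq_of_lt c.2]
    · rw [← pow_mul, Nat.mul_comm, pow_mul, hζ.pow_eq_one, one_pow]
    · exact hζ.pow_ne_one_of_pos_of_lt hb b.2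
  · refine Finset.sum_eq_zero fun c _ => if_neg fun h => ?_
    have := a.2
    have := c.2
    rcases lt_or_ge ((c : ℕ) + a) d with h' | h'
    · rw [Nat.mod_eq_of_lt h'] at h; omega
    · rw [Nat.mod_eq_sub_mod h', Nat.mod_eq_of_lt (by omega)] at h; omega

lemma partialTraceZero_pauliOn [NeZero d] [DecidableEq ι] {a b : ι → Fin d} {s : ι}
    (hs : (a s : ℕ) ≠ 0 ∨ (b s : ℕ) ≠ 0) : PartialTraceZero s (pauliOn a b) := by
  intro x y
  simp only [pauliOn]
  have : ∀ c, ∏ i, sitePauli d (a i) (b i) (Function.update x s c i) (Function.update y s c i) =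
      sitePauli d (a s) (b s) c c *
        ∏ i ∈ Finset.univ.erase s, sitePauli d (a i) (b i) (x i) (y i) := by
    intro c
    rw [← Finset.mul_prod_erase _ _ (Finset.mem_univ s)]
    congr 1
    · simp
    · refine Finset.prod_congr rfl fun i hi => ?_
      simp [Finset.ne_of_mem_erase hi]
  simp only [this]
  rw [← Finset.sum_mul, sum_sitePauli_diag hs, zero_mul]

lemma place_pauliOn [NeZero d] {f : ι → κ} (hf : f.Injective) (a b : κ → Fin d)
    (h0 : ∀ i, i ∉ Set.range f → a i = 0 ∧ b i = 0) :
    place f (pauliOn (a ∘ f) (b ∘ f)) = pauliOn a b := by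
  classical
  ext x y
  rw [pauliOn, ← Fintype.prod_subtype_mul_prod_subtype (fun i => i ∈ Set.range f), place]
  congr 1
  · convert Equiv.prod_comp (Equiv.ofInjective f hf)
      (fun i : Set.range f => sitePauli d (a i) (b i) (x i) (y i))
    rfl
  · rw [Finset.prod_congr rfl (g := fun i : {i // i ∉ Set.range f} =>
      if x (i : κ) = y i then 1 else 0), Fintype.prod_boole]
    · by_cases h : ∀ i, i ∉ Set.range f → x i = y i
      · rw [if_pos h, if_pos fun i : {i // i ∉ Set.range f} => h i i.2]
      · rw [if_neg h, if_neg fun h' => h fun i hi => h' ⟨i, hi⟩]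
    · intro i _
      rw [(h0 i i.2).1, (h0 i i.2).2, sitePauli_zero]

lemma pauliOn_sumElim (a b : ι → Fin d) (a' b' : κ → Fin d) :
    pauliOn (Sum.elim a a') (Sum.elim b b') = tensorOp (pauliOn a b) (pauliOn a' b') := by
  ext x y
  simp [pauliOn, tensorOp_apply]

lemma sum_sitePauli_mul_star [NeZero d] (u v x y : Fin d) :
    ∑ p : Fin d × Fin d, sitePauli d p.1 p.2 u v * star (sitePauli d p.1 p.2 x y) =
      if x = u ∧ y = v then (d : ℂ) else 0 := by
  set ζ := Complex.exp (2 * Real.pi * Complex.I / d) with hζdef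
  have hζ : IsPrimitiveRoot ζ d := Complex.isPrimitiveRoot_exp d (NeZero.ne d)
  have hstar : star ζ = ζ⁻¹ := by
    rw [hζdef, ← Complex.exp_neg, Complex.star_def, ← Complex.exp_conj]
    congr 1
    rw [map_div₀, map_mul, map_mul, Complex.conj_ofReal, Complex.conj_I, Complex.conj_natCast,
      Complex.conj_ofNat]
    ring
  have hval : ∀ a x y : Fin d, (x : ℕ) = ((y : ℕ) + (a : ℕ)) % d ↔ a = x - y := by
    intro a x y
    rw [← Fin.val_add, ← Fin.ext_iff, eq_sub_iff_add_eq', eq_comm]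
  have hb : ∑ b : Fin d, Complex.exp (2 * Real.pi * Complex.I * (b : ℕ) * (v : ℕ) / d) *
      star (Complex.exp (2 * Real.pi * Complex.I * (b : ℕ) * (y : ℕ) / d)) =
      if y = v then (d : ℂ) else 0 := by
    have : ∀ b : Fin d, Complex.exp (2 * Real.pi * Complex.I * (b : ℕ) * (v : ℕ) / d) *
      star (Complex.exp (2 * Real.pi * Complex.I * (b : ℕ) * (y : ℕ) / d)) =
        (ζ ^ (v : ℕ) * (ζ ^ (y : ℕ))⁻¹) ^ (b : ℕ) := by
      intro b
      rw [exp_eq_pow, exp_eq_pow, star_pow, star_pow, hstar, mul_pow, inv_pow, inv_pow, inv_pow,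
        ← pow_mul, ← pow_mul, ← pow_mul, ← pow_mul, mul_comm (b : ℕ), mul_comm (b : ℕ)]
    rw [Finset.sum_congr rfl fun b _ => this b]
    have h0 : ∀ n : ℕ, ζ ^ n ≠ 0 := fun n => pow_ne_zero _ (Complex.exp_ne_zero _)
    split_ifs with h
    · subst h
      simp [mul_inv_cancel₀ (h0 _)]
    · apply sum_pow_eq_zero
      · have h1 : ∀ n : ℕ, (ζ ^ n) ^ d = 1 := fun n => by
          rw [← pow_mul, Nat.mul_comm, pow_mul, hζ.pow_eq_one, one_pow]
        rw [mul_pow, inv_pow, h1, h1, inv_one, one_mul]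
      · rw [Ne, mul_inv_eq_one₀ (h0 _)]
        intro h'
        exact h (Fin.ext (hζ.pow_inj v.2 y.2 h').symm)
  rw [Fintype.sum_prod_type]
  simp only [sitePauli, hval]
  have hterm : ∀ a : Fin d, (∑ b : Fin d,
      (if a = u - v then Complex.exp (2 * Real.pi * Complex.I * (b : ℕ) * (v : ℕ) / d) else 0) *
      star (if a = x - y then Complex.exp (2 * Real.pi * Complex.I * (b : ℕ) * (y : ℕ) / d)
        else 0)) = if a = u - v then (if u - v = x - y ∧ y = v then (d : ℂ) else 0) else 0 := by
    intro a
    by_cases h1 : a = u - v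
    · subst h1
      by_cases h2 : u - v = x - y
      · simp only [h2, if_true, true_and, hb]
      · simp [h2]
    · simp [h1]
  rw [Finset.sum_congr rfl fun a _ => hterm a, Finset.sum_ite_eq' , if_pos (Finset.mem_univ _)]
  refine if_congr ?_ rfl rfl
  constructor
  · rintro ⟨h1, rfl⟩
    exact ⟨(sub_left_injective h1).symm, rfl⟩
  · rintro ⟨rfl, rfl⟩
    exact ⟨rfl, rfl⟩

/-- An operator whose Hilbert–Schmidt products with all Pauli strings trivial at `s` vanish has
zero partial trace over `s`. -/
lemma partialTraceZero_of_trace_pauliOn [NeZero d] [DecidableEq ι] {s : ι}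
    {h : Matrix (ι → Fin d) (ι → Fin d) ℂ}
    (hh : ∀ a b : ι → Fin d, a s = 0 → b s = 0 → ((pauliOn a b)ᴴ * h).trace = 0) :
    PartialTraceZero s h := by
  intro u₀ v₀
  set u := Function.update u₀ s 0 with hu
  set v := Function.update v₀ s 0 with hv
  have huv : u s = v s := by simp [hu, hv]
  let t : ι → Finset (Fin d × Fin d) := fun i => if i = s then {(0, 0)} else Finset.univ
  have hzero : ∑ p ∈ Fintype.piFinset t, pauliOn (fun i => (p i).1) (fun i => (p i).2) u v *
      ((pauliOn (fun i => (p i).1) (fun i => (p i).2))ᴴ * h).trace = 0 := by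
    refine Finset.sum_eq_zero fun p hp => ?_
    have hps : p s = (0, 0) := by
      have := Fintype.mem_piFinset.1 hp s
      simpa [t] using this
    rw [hh _ _ (by rw [hps]) (by rw [hps]), mul_zero]
  have hw : ∀ x y : ι → Fin d, ∑ p ∈ Fintype.piFinset t,
      pauliOn (fun i => (p i).1) (fun i => (p i).2) u v *
        star (pauliOn (fun i => (p i).1) (fun i => (p i).2) x y) =
      (if x s = y s then 1 else 0) *
        ∏ i ∈ Finset.univ.erase s, if x i = u i ∧ y i = v i then (d : ℂ) else 0 := by
    intro x y
    simp only [pauliOn, star_prod, ← Finset.prod_mul_distrib]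
    rw [← Finset.prod_univ_sum t (fun i p => sitePauli d p.1 p.2 (u i) (v i) *
      star (sitePauli d p.1 p.2 (x i) (y i))), ← Finset.mul_prod_erase _ _ (Finset.mem_univ s)]
    congr 1
    · simp [t, sitePauli_zero, huv]
    · refine Finset.prod_congr rfl fun i hi => ?_
      simp only [t, if_neg (Finset.ne_of_mem_erase hi)]
      exact sum_sitePauli_mul_star _ _ _ _
  have hexp : ∀ p : ι → Fin d × Fin d,
      ((pauliOn (fun i => (p i).1) (fun i => (p i).2))ᴴ * h).trace =
        ∑ y, ∑ x, star (pauliOn (fun i => (p i).1) (fun i => (p i).2) x y) * h x y := by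
    intro p
    simp [trace, mul_apply]
  have hsum : ∑ q : (ι → Fin d) × (ι → Fin d), ((if q.2 s = q.1 s then 1 else 0) *
      ∏ i ∈ Finset.univ.erase s, if q.2 i = u i ∧ q.1 i = v i then (d : ℂ) else 0) *
        h q.2 q.1 = 0 := by
    refine Eq.trans ?_ hzero
    rw [Fintype.sum_prod_type]
    simp only [hexp, Finset.mul_sum]
    rw [Finset.sum_comm (s := Fintype.piFinset t)]
    refine Finset.sum_congr rfl fun y _ => ?_
    rw [Finset.sum_comm (s := Fintype.piFinset t)]
    refine Finset.sum_congr rfl fun x _ => ?_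
    rw [← hw x y, Finset.sum_mul]
    exact Finset.sum_congr rfl fun p _ => mul_assoc _ _ _
  have hinj : ∑ c : Fin d, (∏ i ∈ Finset.univ.erase s, (d : ℂ)) *
      h (Function.update u₀ s c) (Function.update v₀ s c) = 0 := by
    refine Eq.trans ?_ hsum
    refine Finset.sum_of_injOn (fun c => (Function.update v₀ s c, Function.update u₀ s c))
      ?_ (by simp) ?_ ?_
    · intro c _ c' _ hcc
      exact Function.update_injective v₀ s (congrArg Prod.fst hcc)
    · rintro ⟨y, x⟩ _ hxy
      by_cases hs : x s = y s
      · by_cases hi : ∀ i, i ≠ s → x i = u i ∧ y i = v i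
        · refine absurd ⟨y s, by simp, ?_⟩ hxy
          refine Prod.ext (funext fun i => ?_) (funext fun i => ?_)
          · by_cases his : i = s
            · subst his; simp
            · simp [his, (hi i his).2, hv]
          · by_cases his : i = s
            · subst his; simp [hs]
            · simp [his, (hi i his).1, hu]
        · push Not at hi
          obtain ⟨i, his, hi⟩ := hi
          rw [Finset.prod_eq_zero (Finset.mem_erase.2 ⟨his, Finset.mem_univ i⟩)
            (if_neg fun h' => hi h'.1 h'.2), mul_zero, zero_mul]
      · simp [hs]
    · intro c _
      simp only [Function.update_self, if_true, one_mul]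
      congr 1
      refine Finset.prod_congr rfl fun i hi => ?_
      have := Finset.ne_of_mem_erase hi
      simp [this, hu, hv]
  rw [← Finset.mul_sum, mul_eq_zero] at hinj
  refine hinj.resolve_left (Finset.prod_ne_zero_iff.2 fun i _ => ?_)
  exact_mod_cast NeZero.ne d

end Pauli

section Translation

variable {d : ℕ}

lemma embed_eq_place {m N : ℕ} (hm : m ≤ N) (a : Op d m) :
    embed d m N a = place (Fin.castLE hm) a := by
  classical
  ext x y
  have he : embed d m N a = fun x y => a (fun i => x (Fin.castLE hm i))
      (fun i => y (Fin.castLE hm i)) *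
        if ∀ i : Fin N, m ≤ (i : ℕ) → x i = y i then 1 else 0 := dif_pos hm
  rw [he, place]
  refine congrArg (a (x ∘ Fin.castLE hm) (y ∘ Fin.castLE hm) * ·) ?_
  have hiff : (∀ i : Fin N, m ≤ (i : ℕ) → x i = y i) ↔
      ∀ i, i ∉ Set.range (Fin.castLE hm) → x i = y i := by
    refine forall_congr' fun i => imp_congr_left ?_
    rw [Fin.range_castLE, Set.mem_ofPred_eq, not_lt]
  by_cases h : ∀ i : Fin N, m ≤ (i : ℕ) → x i = y i
  · rw [if_pos h, if_pos (hiff.1 h)]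
  · rw [if_neg h, if_neg fun h' => h (hiff.2 h')]

lemma place_submatrix {ι κ : Type*} (r : Equiv.Perm κ) (f : ι → κ)
    (a : Matrix (ι → Fin d) (ι → Fin d) ℂ) :
    (place f a).submatrix (fun x => x ∘ r) (fun x => x ∘ r) = place (r ∘ f) a := by
  classical
  ext x y
  simp only [submatrix_apply, place]
  congr 1
  refine if_congr ?_ rfl rfl
  constructor
  · intro h i hi
    have := h (r.symm i) fun ⟨j, hj⟩ => hi ⟨j, by simp [hj]⟩
    simpa using this
  · intro h i hi
    exact h (r i) fun ⟨j, hj⟩ => hi ⟨j, r.injective hj⟩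

lemma Tmat_conj {N : ℕ} (B : Op d N) :
    Tmat d N * B * (Tmat d N)ᴴ =
      B.submatrix (fun x => x ∘ finRotate N) (fun x => x ∘ finRotate N) := by
  have hT : ∀ x y, Tmat d N x y = if x ∘ finRotate N = y then 1 else 0 := by
    intro x y
    rw [Tmat]
    refine if_congr ?_ rfl rfl
    exact (Equiv.symm_apply_eq (confShift d N)).symm
  ext x y
  simp [mul_apply, hT]

/-- The sites `l, l + 1, …, l + k - 1` of a periodic chain of length `N`. -/
def window (k N : ℕ) [NeZero N] (l : ℕ) (i : Fin k) : Fin N := Fin.ofNat N (i + l)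

lemma val_window {k N : ℕ} [NeZero N] (l : ℕ) (i : Fin k) :
    (window k N l i : ℕ) = (i + l) % N := rfl

lemma window_injective {k N : ℕ} [NeZero N] (hk : k ≤ N) (l : ℕ) :
    (window k N l).Injective := by
  intro i j hij
  have h : ((i : ℕ) + l) % N = (j + l) % N := congrArg Fin.val hij
  have h' : (i : ℕ) ≡ j [MOD N] := Nat.ModEq.add_right_cancel' l h
  exact Fin.ext (h'.eq_of_lt_of_lt (i.2.trans_le hk) (j.2.trans_le hk))

lemma mem_range_window {k N : ℕ} [NeZero N] (hk : k ≤ N) {l : ℕ} (hl : l < N) {s : Fin N}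
    (hs : s ∈ Set.range (window k N l)) :
    (l ≤ (s : ℕ) ∧ (s : ℕ) < l + k) ∨ (l ≤ (s : ℕ) + N ∧ (s : ℕ) + N < l + k) := by
  obtain ⟨i, rfl⟩ := hs
  rw [val_window]
  have := i.2
  rcases lt_or_ge ((i : ℕ) + l) N with h | h
  · rw [Nat.mod_eq_of_lt h]; omega
  · rw [Nat.mod_eq_sub_mod h, Nat.mod_eq_of_lt (by omega)]; omega

lemma finRotate_ofNat {N : ℕ} [NeZero N] (n : ℕ) :
    finRotate N (Fin.ofNat N n) = Fin.ofNat N (n + 1) := by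
  rw [finRotate_apply]
  ext
  simp [Fin.val_add]

lemma Tmat_pow_conj_embed {k N : ℕ} [NeZero N] (hk : k ≤ N) (h : Op d k) (l : ℕ) :
    Tmat d N ^ l * embed d k N h * (Tmat d N)ᴴ ^ l = place (window k N l) h := by
  induction l with
  | zero =>
    rw [pow_zero, pow_zero, Matrix.one_mul, Matrix.mul_one, embed_eq_place hk]
    congr 1
    ext i
    rw [val_window, add_zero, Nat.mod_eq_of_lt (i.2.trans_le hk), Fin.val_castLE]
  | succ l ih =>
    rw [pow_succ', pow_succ, show Tmat d N * Tmat d N ^ l * embed d k N h *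
      ((Tmat d N)ᴴ ^ l * (Tmat d N)ᴴ) = Tmat d N * (Tmat d N ^ l * embed d k N h *
        (Tmat d N)ᴴ ^ l) * (Tmat d N)ᴴ by simp only [Matrix.mul_assoc], ih, Tmat_conj,
      place_submatrix]
    congr 1
    ext i
    rw [Function.comp_apply, window, finRotate_ofNat, window, add_assoc]

lemma Ham_eq_sum_place {k N : ℕ} [NeZero N] (hk : k ≤ N) (h : Op d k) :
    Ham d k N h = ∑ l : Fin N, place (window k N l) h :=
  Finset.sum_congr rfl fun l _ => Tmat_pow_conj_embed hk h l

lemma embed_eq_place_window {k N : ℕ} [NeZero N] (hk : k ≤ N) (h : Op d k) :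
    embed d k N h = place (window k N 0) h := by
  rw [← Tmat_pow_conj_embed hk h 0, pow_zero, pow_zero, Matrix.one_mul, Matrix.mul_one]

end Translation

section TwoCopies

variable {d k : ℕ}

/-- Exponents of the Pauli string formed by two copies of `a` on `k` sites each, separated by
`k - 1` trivial sites. -/
def twoCopies [NeZero d] (a : Fin k → Fin d) (i : ℕ) : Fin d :=
  if h : i < k then a ⟨i, h⟩
  else if h : 2 * k - 1 ≤ i ∧ i - (2 * k - 1) < k then a ⟨i - (2 * k - 1), h.2⟩
  else 0

lemma twoCopies_left [NeZero d] (a : Fin k → Fin d) (i : Fin k) : twoCopies a i = a i := by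
  simp [twoCopies]

lemma twoCopies_right [NeZero d] (a : Fin k → Fin d) (i : Fin k) :
    twoCopies a (i + (2 * k - 1)) = a i := by
  have h1 : ¬ (i : ℕ) + (2 * k - 1) < k := by have := i.2; omega
  simp [twoCopies, h1]

lemma twoCopies_eq_zero [NeZero d] (a : Fin k → Fin d) {i : ℕ} (h1 : k ≤ i)
    (h2 : ∀ j < k, i ≠ j + (2 * k - 1)) : twoCopies a i = 0 := by
  rw [twoCopies, dif_neg (by omega), dif_neg]
  rintro ⟨h3, h4⟩
  exact h2 _ h4 (by omega)

lemma sumElim_window_injective {N : ℕ} [NeZero N] (hN : 6 * k ≤ N) :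
    (Sum.elim (window k N 0) (window k N (2 * k - 1))).Injective := by
  refine (window_injective (by omega) _).sumElim (window_injective (by omega) _) ?_
  intro i j hij
  have h := congrArg Fin.val hij
  have := i.2
  have := j.2
  rw [val_window, val_window, Nat.mod_eq_of_lt (by omega), Nat.mod_eq_of_lt (by omega)] at h
  omega

lemma embed_pauli_twoCopies [NeZero d] {N : ℕ} (hN : 6 * k ≤ N) (a b : Fin k → Fin d) :
    embed d (3 * k - 1) N (pauli d (3 * k - 1) (fun i => twoCopies a i)
      (fun i => twoCopies b i)) =
      pauliOn (fun i : Fin N => twoCopies a i) (fun i : Fin N => twoCopies b i) := by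
  have hm : 3 * k - 1 ≤ N := by omega
  rw [embed_eq_place hm, pauli_eq_pauliOn]
  refine place_pauliOn (Fin.castLE_injective hm) (fun i : Fin N => twoCopies a i)
    (fun i : Fin N => twoCopies b i) fun i hi => ?_
  rw [Fin.range_castLE, Set.mem_ofPred_eq, not_lt] at hi
  rcases Nat.eq_zero_or_pos k with rfl | hk
  · simp [twoCopies]
  · exact ⟨twoCopies_eq_zero _ (by omega) (by omega), twoCopies_eq_zero _ (by omega) (by omega)⟩

lemma pauliOn_twoCopies [NeZero d] {N : ℕ} [NeZero N] (hN : 6 * k ≤ N) (a b : Fin k → Fin d) :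
    pauliOn (fun i : Fin N => twoCopies a i) (fun i : Fin N => twoCopies b i) =
      place (Sum.elim (window k N 0) (window k N (2 * k - 1)))
        (tensorOp (pauliOn a b) (pauliOn a b)) := by
  have hcomp : ∀ a : Fin k → Fin d, (fun i : Fin N => twoCopies a i) ∘
      Sum.elim (window k N 0) (window k N (2 * k - 1)) = Sum.elim a a := by
    intro a
    ext (i | i)
    · have := i.2
      simp only [Function.comp_apply, Sum.elim_inl, val_window]
      rw [Nat.mod_eq_of_lt (by omega), add_zero, twoCopies_left]
    · have := i.2
      simp only [Function.comp_apply, Sum.elim_inr, val_window]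
      rw [Nat.mod_eq_of_lt (by omega), twoCopies_right]
  rw [← pauliOn_sumElim, ← hcomp a, ← hcomp b]
  refine (place_pauliOn (sumElim_window_injective hN) _ _ fun i hi => ?_).symm
  have hl : k ≤ (i : ℕ) := by
    by_contra! h
    refine hi ⟨Sum.inl ⟨i, h⟩, Fin.ext ?_⟩
    rw [Sum.elim_inl, val_window, add_zero, Nat.mod_eq_of_lt i.2]
  have hr : ∀ j < k, (i : ℕ) ≠ j + (2 * k - 1) := by
    intro j hj h
    refine hi ⟨Sum.inr ⟨j, hj⟩, Fin.ext ?_⟩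
    rw [Sum.elim_inr, val_window, ← h, Nat.mod_eq_of_lt i.2]
  exact ⟨twoCopies_eq_zero _ hl hr, twoCopies_eq_zero _ hl hr⟩

lemma trace_Ham_mul [NeZero d] {N : ℕ} [NeZero N] (hN : k ≤ N) (h : Op d k) (C : Op d N) :
    (Ham d k N h * C).trace = ∑ l : Fin N, (place (window k N l) h * C).trace := by
  rw [Ham_eq_sum_place hN, Matrix.sum_mul, trace_sum]

lemma trace_Ham_sq_mul [NeZero d] {N : ℕ} [NeZero N] (hN : k ≤ N) (h : Op d k) (C : Op d N) :
    (Ham d k N h ^ 2 * C).trace = ∑ p : Fin N × Fin N,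
      (place (window k N p.1) h * place (window k N p.2) h * C).trace := by
  rw [Ham_eq_sum_place hN, sq, Matrix.sum_mul, Matrix.sum_mul, trace_sum, Fintype.sum_prod_type]
  refine Finset.sum_congr rfl fun l _ => ?_
  rw [Matrix.mul_sum, Matrix.sum_mul, trace_sum]

open scoped ComplexOrder in
/-- If `h` has zero partial trace over its first site, then `tr (H_N h) ≠ 0`. -/
lemma trace_Ham_mul_embed_ne_zero (hd : 2 ≤ d) {h : Op d k} (hk : 1 ≤ k)
    (hherm : h.IsHermitian) (hne : h ≠ 0) (hpt : PartialTraceZero ⟨0, hk⟩ h) {N : ℕ}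
    (hN : 6 * k ≤ N) : (Ham d k N h * embed d k N h).trace ≠ 0 := by
  have : NeZero d := ⟨by omega⟩
  have : NeZero N := ⟨by omega⟩
  have hkN : k ≤ N := by omega
  have hval : ∀ l : Fin N, (window k N l ⟨0, hk⟩ : ℕ) = l := fun l => by
    rw [val_window, Nat.zero_add, Nat.mod_eq_of_lt l.2]
  rw [trace_Ham_mul hkN, embed_eq_place_window hkN, Finset.sum_eq_single (0 : Fin N)]
  · rw [Fin.val_zero, place_mul _ (window_injective hkN 0)]
    refine trace_place_ne_zero hd _ (window_injective hkN 0) fun h0 => hne ?_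
    rw [← trace_conjTranspose_mul_self_eq_zero_iff, hherm.eq, h0]
  · intro l _ hl
    have hl' : (l : ℕ) ≠ 0 := fun h => hl (Fin.ext h)
    by_cases h0 : (0 : Fin N) ∈ Set.range (window k N l)
    · rw [trace_mul_comm]
      refine trace_mul_eq_zero (actsTriviallyAt_place (s := window k N l ⟨0, hk⟩) (fun hs => ?_) h)
        (partialTraceZero_place (window_injective hkN l) hpt)
      have h1 := mem_range_window hkN l.2 h0
      have h2 := mem_range_window hkN (by omega) hs
      rw [hval] at h2
      rw [Fin.val_zero] at h1
      have := l.2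
      omega
    · have hw : window k N 0 ⟨0, hk⟩ = 0 := Fin.ext (hval 0)
      refine trace_mul_eq_zero (actsTriviallyAt_place h0 h) ?_
      rw [← hw]
      exact partialTraceZero_place (window_injective hkN 0) hpt
  · simp

lemma partialTraceZero_twoCopies [NeZero d] {m : ℕ} {a b : Fin k → Fin d} {s : Fin m} (j : Fin k)
    (hj : (a j : ℕ) ≠ 0 ∨ (b j : ℕ) ≠ 0)
    (hs : (s : ℕ) = j ∨ (s : ℕ) = j + (2 * k - 1)) :
    PartialTraceZero s
      (pauliOn (fun i : Fin m => twoCopies a i) (fun i : Fin m => twoCopies b i)) := by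
  apply partialTraceZero_pauliOn
  rcases hs with hs | hs
  · rwa [hs, twoCopies_left, twoCopies_left]
  · rwa [hs, twoCopies_right, twoCopies_right]

/-- If the Pauli string `(a, b)` acts nontrivially at both ends, then the only terms of `H_N²`
overlapping with two separated copies of it are those supported exactly on the two copies. -/
lemma trace_Ham_sq_mul_twoCopies [NeZero d] {h : Op d k} (hk : 1 ≤ k) {a b : Fin k → Fin d}
    (hfirst : (a ⟨0, hk⟩ : ℕ) ≠ 0 ∨ (b ⟨0, hk⟩ : ℕ) ≠ 0)
    (hlast : (a ⟨k - 1, by omega⟩ : ℕ) ≠ 0 ∨ (b ⟨k - 1, by omega⟩ : ℕ) ≠ 0)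
    {N : ℕ} [NeZero N] (hN : 6 * k ≤ N) :
    (Ham d k N h ^ 2 *
      pauliOn (fun i : Fin N => twoCopies a i) (fun i : Fin N => twoCopies b i)).trace =
      2 * (place (Sum.elim (window k N 0) (window k N (2 * k - 1)))
        (tensorOp (h * pauliOn a b) (h * pauliOn a b))).trace := by
  have hkN : k ≤ N := by omega
  have hinj := sumElim_window_injective hN
  rw [trace_Ham_sq_mul hkN, Finset.sum_eq_add (⟨0, by omega⟩, ⟨2 * k - 1, by omega⟩)
    (⟨2 * k - 1, by omega⟩, ⟨0, by omega⟩), two_mul (trace _)]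
  · simp only
    rw [pauliOn_twoCopies hN, place_eq_place_tensorOp_one _ _ hinj,
      place_eq_place_one_tensorOp _ _ hinj, place_mul _ hinj, place_mul _ hinj, place_mul _ hinj,
      place_mul _ hinj, tensorOp_mul, tensorOp_mul, tensorOp_mul, tensorOp_mul]
    simp only [Matrix.mul_one, Matrix.one_mul]
  · intro h
    have := congrArg (fun p => (p.1 : ℕ)) h
    simp only at this
    omega
  · rintro ⟨l, l'⟩ _ ⟨h1, h2⟩
    have hsite : ∀ s : Fin N, PartialTraceZero s (pauliOn (fun i : Fin N => twoCopies a i)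
        (fun i : Fin N => twoCopies b i)) → s ∉ Set.range (window k N l) →
        s ∉ Set.range (window k N l') → (place (window k N l) h * place (window k N l') h *
          pauliOn (fun i : Fin N => twoCopies a i) (fun i : Fin N => twoCopies b i)).trace = 0 :=
      fun s hs hl hl' =>
        trace_mul_eq_zero ((actsTriviallyAt_place hl h).mul (actsTriviallyAt_place hl' h)) hs
    by_contra hne
    have hcover : ∀ s : Fin N, PartialTraceZero s (pauliOn (fun i : Fin N => twoCopies a i)
        (fun i : Fin N => twoCopies b i)) →
        s ∈ Set.range (window k N l) ∨ s ∈ Set.range (window k N l') := by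
      intro s hs
      by_contra! hc
      exact hne (hsite s hs hc.1 hc.2)
    have hcover' := fun s hs => (hcover s hs).imp (mem_range_window hkN l.2)
      (mem_range_window hkN l'.2)
    have c1 := hcover' ⟨0, by omega⟩
      (partialTraceZero_twoCopies ⟨0, hk⟩ hfirst (Or.inl rfl))
    have c2 := hcover' ⟨k - 1, by omega⟩
      (partialTraceZero_twoCopies ⟨k - 1, by omega⟩ hlast (Or.inl rfl))
    have c3 := hcover' ⟨0 + (2 * k - 1), by omega⟩
      (partialTraceZero_twoCopies ⟨0, hk⟩ hfirst (Or.inr rfl))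
    have c4 := hcover' ⟨k - 1 + (2 * k - 1), by omega⟩
      (partialTraceZero_twoCopies ⟨k - 1, by omega⟩ hlast (Or.inr rfl))
    simp only [ne_eq, Prod.mk.injEq, Fin.ext_iff] at h1 h2
    simp only at c1 c2 c3 c4
    have := l.2
    have := l'.2
    omega
  · simp
  · simp

lemma trace_Ham_mul_twoCopies [NeZero d] {h : Op d k} (hk : 1 ≤ k) {a b : Fin k → Fin d}
    (hfirst : (a ⟨0, hk⟩ : ℕ) ≠ 0 ∨ (b ⟨0, hk⟩ : ℕ) ≠ 0) {N : ℕ} [NeZero N] (hN : 6 * k ≤ N) :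
    (Ham d k N h *
      pauliOn (fun i : Fin N => twoCopies a i) (fun i : Fin N => twoCopies b i)).trace = 0 := by
  have hkN : k ≤ N := by omega
  rw [trace_Ham_mul hkN]
  refine Finset.sum_eq_zero fun l _ => ?_
  by_cases h0 : (⟨0, by omega⟩ : Fin N) ∈ Set.range (window k N l)
  · refine trace_mul_eq_zero (s := ⟨0 + (2 * k - 1), by omega⟩)
      (actsTriviallyAt_place (fun hs => ?_) h)
      (partialTraceZero_twoCopies ⟨0, hk⟩ hfirst (Or.inr rfl))
    have h1 := mem_range_window hkN l.2 h0
    have h2 := mem_range_window hkN l.2 hs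
    simp only at h1 h2
    have := l.2
    omega
  · exact trace_mul_eq_zero (actsTriviallyAt_place h0 h)
      (partialTraceZero_twoCopies ⟨0, hk⟩ hfirst (Or.inl rfl))

end TwoCopies

/-- If `h` is nonzero, canonical, and exactly `k`-local, then there is a
traceless operator `A` on the first `3k - 1` sites — which may be taken to be a single
generalized Pauli string — such that for all sufficiently large `N`, `tr(H_N A) = 0` and
`tr(H_N² A) ≠ 0`; in particular
`(tr(H_N h)/d)(tr(H_N² A)/d) ≠ (tr(H_N² h)/d)(tr(H_N A)/d)`. -/
theorem exists_pauli_violating_trace_identity (dloc k : ℕ) (hdloc : 2 ≤ dloc) (hk : 1 ≤ k)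
    (h : Op dloc k) (hherm : h.IsHermitian) (htr : h.trace = 0) (hnorm : opNorm h = 1)
    (hne : h ≠ 0) (hcan : Canonical dloc k h) (hexact : ExactlyLocal dloc k h) :
    ∃ A : Op dloc (3 * k - 1),
      (∃ a b : Fin (3 * k - 1) → Fin dloc, A = pauli dloc (3 * k - 1) a b) ∧
      A.trace = 0 ∧
      ∃ N₀ : ℕ, ∀ N : ℕ, N₀ ≤ N →
        (Ham dloc k N h * embed dloc (3 * k - 1) N A).trace = 0 ∧
        (Ham dloc k N h ^ 2 * embed dloc (3 * k - 1) N A).trace ≠ 0 ∧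
        ((Ham dloc k N h * embed dloc k N h).trace / (dloc : ℂ) ^ N) *
            ((Ham dloc k N h ^ 2 * embed dloc (3 * k - 1) N A).trace / (dloc : ℂ) ^ N) ≠
          ((Ham dloc k N h ^ 2 * embed dloc k N h).trace / (dloc : ℂ) ^ N) *
            ((Ham dloc k N h * embed dloc (3 * k - 1) N A).trace / (dloc : ℂ) ^ N) := by
  have : NeZero dloc := ⟨by omega⟩
  obtain ⟨a, b, i, hi, hlast, hcoef⟩ := hexact
  have hi' : i = ⟨k - 1, Nat.sub_lt hk Nat.one_pos⟩ := Fin.ext hi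
  subst hi'
  have hfirst : (a ⟨0, hk⟩ : ℕ) ≠ 0 ∨ (b ⟨0, hk⟩ : ℕ) ≠ 0 := by
    by_contra! h0
    refine hcoef (hcan a b fun i hi => ?_)
    obtain rfl : i = ⟨0, hk⟩ := Fin.ext hi
    exact h0
  have hpt : PartialTraceZero ⟨0, hk⟩ h := by
    refine partialTraceZero_of_trace_pauliOn fun a b ha hb => ?_
    rw [← pauli_eq_pauliOn]
    refine hcan a b fun i hi => ?_
    obtain rfl : i = ⟨0, hk⟩ := Fin.ext hi
    simp [ha, hb]
  have hcoef' : (h * pauliOn a b).trace ≠ 0 := by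
    intro h0
    apply hcoef
    rw [pauli_eq_pauliOn, ← conjTranspose_conjTranspose h, ← conjTranspose_mul,
      trace_conjTranspose, hherm.eq, h0, star_zero]
  refine ⟨pauli dloc (3 * k - 1) (fun i => twoCopies a i) (fun i => twoCopies b i),
    ⟨_, _, rfl⟩, ?_, 6 * k, fun N hN => ?_⟩
  · rw [pauli_eq_pauliOn, ← Matrix.one_mul (pauliOn _ _)]
    exact trace_mul_eq_zero (actsTriviallyAt_one ⟨0, by omega⟩)
      (partialTraceZero_twoCopies ⟨0, hk⟩ hfirst (Or.inl rfl))
  · have : NeZero N := ⟨by omega⟩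
    have hdN : (dloc : ℂ) ^ N ≠ 0 := pow_ne_zero _ (by exact_mod_cast NeZero.ne dloc)
    have hone := trace_Ham_mul_twoCopies (h := h) hk hfirst hN
    have htwo : (Ham dloc k N h ^ 2 * pauliOn (fun i : Fin N => twoCopies a i)
        (fun i : Fin N => twoCopies b i)).trace ≠ 0 := by
      rw [trace_Ham_sq_mul_twoCopies hk hfirst hlast hN]
      refine mul_ne_zero two_ne_zero
        (trace_place_ne_zero hdloc _ (sumElim_window_injective hN) ?_)
      rw [trace_tensorOp]
      exact mul_ne_zero hcoef' hcoef'
    rw [embed_pauli_twoCopies hN]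
    refine ⟨hone, htwo, ?_⟩
    rw [hone, zero_div, mul_zero]
    exact mul_ne_zero
      (div_ne_zero (trace_Ham_mul_embed_ne_zero hdloc hk hherm hne hpt hN) hdN)
      (div_ne_zero htwo hdN)
end
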